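/- Let 𝒜 be an elliptic homogeneous constant-coefficient differential operator of order k = n ≥ 1 on ℝ^n. Then the following are equivalent: (1) 𝒜 satisfies condition (WC); (2) W^{𝒜,1}(ℝ^n) embeds continuously into C_0(ℝ^n, V), the continuous V-valued maps vanishing at infinity; (3) BV^𝒜(ℝ^n) ⊂ L^∞(ℝ^n, V), with ‖u‖_{L^∞} ≤ c |𝒜u|(ℝ^n) for all u ∈ BV^𝒜(ℝ^n) and some constant c independent of u. -/

import Mathlib

open MeasureTheory Metric Filter
open scoped ENNReal RealInnerProductSpace Topology

noncomputable section

/-- Euclidean space `ℝ^n`. -/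
abbrev Euc (n : ℕ) : Type := EuclideanSpace ℝ (Fin n)

/-- The `i`-th standard basis vector of `ℝ^n`. -/
def stdVec (n : ℕ) (i : Fin n) : Euc n := EuclideanSpace.single i (1 : ℝ)

/-- Coefficients `A_I : V →ₗ W` (indexed by `I : Fin k → Fin n`) of a homogeneous linear
constant-coefficient differential operator `𝒜 u = ∑_I A_I ∂_I u` of order `k` on `ℝ^n`. -/
abbrev CoeffOp (n k : ℕ) (V W : Type*) [NormedAddCommGroup V] [InnerProductSpace ℝ V]
    [NormedAddCommGroup W] [InnerProductSpace ℝ W] : Type _ :=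
  (Fin k → Fin n) → (V →ₗ[ℝ] W)

variable {V W F : Type*}
  [NormedAddCommGroup V] [InnerProductSpace ℝ V] [FiniteDimensional ℝ V]
  [NormedAddCommGroup W] [InnerProductSpace ℝ W] [FiniteDimensional ℝ W]

/-- The coefficients represent a linear map on symmetric tensors `V ⊙^k ℝ^n`. -/
def IsSymmetricOp (n k : ℕ) (A : CoeffOp n k V W) : Prop :=
  ∀ (I : Fin k → Fin n) (σ : Equiv.Perm (Fin k)), A (I ∘ σ) = A I

/-- The symbol `𝒜[ξ] v = A (v ⊗^k ξ) = ∑_I (∏ i, ξ_{I i}) A_I v`. -/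
def symbolMap (n k : ℕ) (A : CoeffOp n k V W) (ξ : Euc n) : V →ₗ[ℝ] W :=
  ∑ I : Fin k → Fin n, (∏ i, ξ (I i)) • A I

/-- Ellipticity: the symbol is injective for all `ξ ≠ 0`. -/
def IsElliptic (n k : ℕ) (A : CoeffOp n k V W) : Prop :=
  ∀ ξ : Euc n, ξ ≠ 0 → Function.Injective (symbolMap n k A ξ)

/-- Van Schaftingen's cancellation condition: `⋂_{ξ ∈ 𝕊^{n-1}} im 𝒜[ξ] = {0}`. -/
def IsCanceling (n k : ℕ) (A : CoeffOp n k V W) : Prop :=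
  (⋂ ξ ∈ sphere (0 : Euc n) 1, (LinearMap.range (symbolMap n k A ξ) : Set W)) = {0}

/-- Inverse of an endomorphism (junk value when not invertible), via matrix inversion. -/
def linInv (f : V →ₗ[ℝ] V) : V →ₗ[ℝ] V :=
  letI b := Module.finBasis ℝ V
  Matrix.toLin b b ((LinearMap.toMatrix b b f)⁻¹)

/-- `𝒜†[ξ] = (𝒜*[ξ] 𝒜[ξ])⁻¹ 𝒜*[ξ]`. -/
def Adagger (n k : ℕ) (A : CoeffOp n k V W) (ξ : Euc n) : W →ₗ[ℝ] V :=
  linInv (LinearMap.adjoint (symbolMap n k A ξ) ∘ₗ symbolMap n k A ξ) ∘ₗ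
    LinearMap.adjoint (symbolMap n k A ξ)

/-- Condition (WC): for every `w ∈ ⋂_{ξ ∈ 𝕊^{n-1}} im 𝒜[ξ]`,
`∫_{𝕊^{n-1}} 𝒜†[ξ] w ⊗^{k-n} ξ dℋ^{n-1}(ξ) = 0`, written componentwise in the
tensor coordinates indexed by `J : Fin (k-n) → Fin n`. -/
def IsWeaklyCanceling (n k : ℕ) (A : CoeffOp n k V W) : Prop :=
  ∀ w : W, (∀ ξ ∈ sphere (0 : Euc n) 1, w ∈ LinearMap.range (symbolMap n k A ξ)) →
    ∀ J : Fin (k - n) → Fin n,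
      (∫ ξ in sphere (0 : Euc n) 1,
        (∏ i, ξ (J i)) • (Adagger n k A ξ w) ∂(μH[(n : ℝ) - 1])) = 0

section TestFun

variable [NormedAddCommGroup F] [NormedSpace ℝ F]

/-- Compactly supported smooth test function. -/
def IsTestFun (n : ℕ) (φ : Euc n → F) : Prop :=
  ContDiff ℝ (⊤ : ℕ∞) φ ∧ HasCompactSupport φ

/-- Iterated directional derivative `∂_{I 0} ⋯ ∂_{I (m-1)} φ (x)`. -/
def dirDeriv (n m : ℕ) (I : Fin m → Fin n) (φ : Euc n → F) (x : Euc n) : F :=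
  iteratedFDeriv ℝ m φ x (fun i => stdVec n (I i))

/-- Smooth functions of degree-`≤ j` polynomial type. -/
def IsPolyDeg (n : ℕ) (j : ℕ) (P : Euc n → F) : Prop :=
  ContDiff ℝ (⊤ : ℕ∞) P ∧ ∀ x, iteratedFDeriv ℝ (j + 1) P x = 0

end TestFun

/-- Pointwise application of the operator `𝒜` to a smooth map. -/
def Aapply (n k : ℕ) (A : CoeffOp n k V W) (u : Euc n → V) (x : Euc n) : W :=
  ∑ I : Fin k → Fin n, A I (dirDeriv n k I u x)

/-- `𝒜 u = f σ` (a `W`-valued measure with total-variation measure `σ` and polar density `f`)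
in the sense of distributions. -/
def HasDistribA (n k : ℕ) (A : CoeffOp n k V W) (u : Euc n → V) (σ : Measure (Euc n))
    (f : Euc n → W) : Prop :=
  ∀ φ : Euc n → W, IsTestFun n φ →
    ((-1 : ℝ) ^ k) * (∑ I : Fin k → Fin n,
        ∫ x, ⟪u x, LinearMap.adjoint (A I) (dirDeriv n k I φ x)⟫) =
      ∫ x, ⟪f x, φ x⟫ ∂σ

/-- `u ∈ BV^𝒜_loc(ℝ^n)`: `u` is locally integrable and `𝒜 u` is a `W`-valued Radon measure,
given by its polar decomposition `f σ` with `σ` locally finite and `‖f‖ = 1` σ-a.e. -/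
def MemBVAloc (n k : ℕ) (A : CoeffOp n k V W) (u : Euc n → V) : Prop :=
  LocallyIntegrable u volume ∧
    ∃ (σ : Measure (Euc n)) (f : Euc n → W), IsLocallyFiniteMeasure σ ∧
      LocallyIntegrable f σ ∧ (∀ᵐ x ∂σ, ‖f x‖ = 1) ∧ HasDistribA n k A u σ f

/-- `v` is the family of weak derivatives of order `m` of `u` (componentwise, indexed by
`I : Fin m → Fin n`). -/
def IsWeakDerivFamily (n m : ℕ) (u : Euc n → V) (v : (Fin m → Fin n) → Euc n → V) : Prop :=
  (∀ I, LocallyIntegrable (v I) volume) ∧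
    ∀ (I : Fin m → Fin n) (φ : Euc n → ℝ), IsTestFun n φ →
      ∫ x, (dirDeriv n m I φ x) • u x = ((-1 : ℝ) ^ m) • ∫ x, φ x • v I x

/-- `Q r = o(r^a)` as `r ↓ 0`. -/
def SmallO (Q : ℝ → ℝ≥0∞) (a : ℝ) : Prop :=
  Tendsto (fun r => Q r / ENNReal.ofReal (r ^ a)) (𝓝[>] (0 : ℝ)) (𝓝 0)

section Spaces

variable [NormedAddCommGroup F] [NormedSpace ℝ F]

/-- `f ∈ t^{j,p}(x)`: there is a polynomial `P` of degree at most `j` with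
`(⨍_{B_r(x)} |f - P|^p)^{1/p} = o(r^j)` as `r ↓ 0`. -/
def MemT (n : ℕ) (j : ℕ) (p : ℝ) (f : Euc n → F) (x : Euc n) : Prop :=
  ∃ P : Euc n → F, IsPolyDeg n j P ∧
    SmallO (fun r => ((volume (ball x r))⁻¹ *
      ∫⁻ y in ball x r, (‖f y - P y‖₊ : ℝ≥0∞) ^ p) ^ (1 / p)) (j : ℝ)

/-- `f ∈ t^{j,∞}(x)`: there is a polynomial `P` of degree at most `j` with
`‖f - P‖_{L^∞(B_r(x))} = o(r^j)` as `r ↓ 0`. -/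
def MemTInf (n : ℕ) (j : ℕ) (f : Euc n → F) (x : Euc n) : Prop :=
  ∃ P : Euc n → F, IsPolyDeg n j P ∧
    SmallO (fun r => essSup (fun y => (‖f y - P y‖₊ : ℝ≥0∞))
      (volume.restrict (ball x r))) (j : ℝ)

/-- The Lorentz `L^{p,q}` quasi-norm (for `p, q < ∞`). -/
def lorentzNorm {α : Type*} [MeasurableSpace α] (p q : ℝ) (μ : Measure α) (f : α → F) : ℝ≥0∞ :=
  ENNReal.ofReal p ^ (1 / q) *
    (∫⁻ t in Set.Ioi (0 : ℝ),
      (ENNReal.ofReal t * (μ {x | t < ‖f x‖}) ^ (1 / p)) ^ q * (ENNReal.ofReal t)⁻¹) ^ (1 / q)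

/-- `f` is `L^{p,q}`-differentiable of order `j` at `x`:
`‖f - P‖_{L^{p,q}(B_r(x))} = o(r^{j + n/p})` for a polynomial `P` of degree at most `j`. -/
def MemTLorentz (n : ℕ) (j : ℕ) (p q : ℝ) (f : Euc n → F) (x : Euc n) : Prop :=
  ∃ P : Euc n → F, IsPolyDeg n j P ∧
    SmallO (fun r => lorentzNorm p q (volume.restrict (ball x r)) (fun y => f y - P y))
      ((j : ℝ) + n / p)

/-- `f ∈ L^p_loc`. -/
def LocLp (n : ℕ) (p : ℝ) (f : Euc n → F) : Prop :=
  ∀ K : Set (Euc n), IsCompact K → ∫⁻ x in K, (‖f x‖₊ : ℝ≥0∞) ^ p < ⊤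

end Spaces

end

section OscillatoryIntegrals

open scoped FourierTransform SchwartzMap Real

variable {n : ℕ} {E E' : Type*} [NormedAddCommGroup E] [InnerProductSpace ℝ E]
  [NormedAddCommGroup E'] [InnerProductSpace ℝ E']

/-- The vector-valued oscillatory integral `∫ Re (ζ e^{-2πi ξ·x}) a(ξ) dξ`. -/
noncomputable def oscInt (ζ : ℂ) (a : Euc n → E) (x : Euc n) : E :=
  ∫ ξ, (ζ * ((𝐞 (-⟪ξ, x⟫) : Circle) : ℂ)).re • a ξ

theorem IsTestFun.integrable {G : Type*} [NormedAddCommGroup G] [NormedSpace ℝ G] {a : Euc n → G}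
    (ha : IsTestFun n a) : Integrable a :=
  ha.1.continuous.integrable_of_hasCompactSupport ha.2

theorem IsTestFun.clm_comp {a : Euc n → E} (ha : IsTestFun n a) (L : E →L[ℝ] E') :
    IsTestFun n (fun ξ => L (a ξ)) :=
  ⟨L.contDiff.comp ha.1, ha.2.comp_left (map_zero L)⟩

theorem IsTestFun.smul {a : Euc n → E} (ha : IsTestFun n a) {p : Euc n → ℝ}
    (hp : ContDiff ℝ (⊤ : ℕ∞) p) : IsTestFun n (fun ξ => p ξ • a ξ) :=
  ⟨hp.smul ha.1, ha.2.smul_left⟩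

theorem oscInt_integrable (ζ : ℂ) {a : Euc n → E} (ha : Integrable a) (x : Euc n) :
    Integrable (fun ξ => (ζ * ((𝐞 (-⟪ξ, x⟫) : Circle) : ℂ)).re • a ξ) := by
  refine ha.bdd_smul (C := ‖ζ‖) ?_ ?_
  · apply Continuous.aestronglyMeasurable
    fun_prop
  · filter_upwards with ξ
    exact (Complex.abs_re_le_norm _).trans (by rw [norm_mul, Circle.norm_coe, mul_one])

theorem oscInt_clm_comp [FiniteDimensional ℝ E] [FiniteDimensional ℝ E'] (ζ : ℂ) {a : Euc n → E} (ha : Integrable a) (L : E →L[ℝ] E')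
    (x : Euc n) : L (oscInt ζ a x) = oscInt ζ (fun ξ => L (a ξ)) x := by
  unfold oscInt
  rw [← L.integral_comp_comm (oscInt_integrable ζ ha x)]
  simp

theorem oscInt_sum {ι : Type*} (s : Finset ι) (ζ : ℂ) {a : ι → Euc n → E}
    (ha : ∀ i ∈ s, Integrable (a i)) (x : Euc n) :
    oscInt ζ (fun ξ => ∑ i ∈ s, a i ξ) x = ∑ i ∈ s, oscInt ζ (a i) x := by
  unfold oscInt
  rw [← integral_finsetSum _ (fun i hi => oscInt_integrable ζ (ha i hi) x)]
  simp [Finset.smul_sum]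

theorem oscInt_smul_arg (ζ : ℂ) (a : Euc n → E) {t : ℝ} (ht : 0 < t) (x : Euc n) :
    oscInt ζ a (t • x) = oscInt ζ (fun ξ => (t ^ n)⁻¹ • a (t⁻¹ • ξ)) x := by
  unfold oscInt
  have := Measure.integral_comp_smul (volume : Measure (Euc n))
    (fun ξ => (ζ * ((𝐞 (-⟪ξ, t • x⟫) : Circle) : ℂ)).re • a ξ) t⁻¹
  simp only [finrank_euclideanSpace, Fintype.card_fin, real_inner_smul_left,
    real_inner_smul_right, mul_inv_cancel_left₀ ht.ne'] at this
  simp_rw [smul_comm _ ((t ^ n)⁻¹), integral_smul]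
  rw [this, inv_pow, inv_inv, abs_of_pos (by positivity), smul_smul,
    inv_mul_cancel₀ (by positivity), one_smul]
  simp only [real_inner_smul_right]

theorem oscInt_zero (ζ : ℂ) (a : Euc n → E) : oscInt ζ a 0 = ζ.re • ∫ ξ, a ξ := by
  simp [oscInt, integral_smul]

theorem oscInt_eq_fourier (ζ : ℂ) {a : Euc n → ℝ} (ha : Integrable a) (x : Euc n) :
    oscInt ζ a x = (ζ * 𝓕 (fun ξ => (a ξ : ℂ)) x).re := by
  rw [Real.fourier_eq, ← integral_const_mul]
  have h := oscInt_integrable (E := ℝ) 1 ha x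
  have hi : Integrable (fun ξ : Euc n => ζ * (𝐞 (-⟪ξ, x⟫) • (a ξ : ℂ))) := by
    apply Integrable.const_mul
    exact (Real.fourierIntegral_convergent_iff (f := fun ξ => (a ξ : ℂ)) x).2 ha.ofReal
  have := Complex.reCLM.integral_comp_comm hi
  simp only [Complex.reCLM_apply] at this
  rw [← this]
  unfold oscInt
  congr 1
  ext ξ
  rw [Circle.smul_def, smul_eq_mul, smul_eq_mul, ← mul_assoc, Complex.re_mul_ofReal]

theorem fourier_schwartz_moments (a : 𝓢(Euc n, ℂ)) (k : ℕ) :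
    Integrable (fun v ↦ ‖v‖ ^ k * ‖a v‖) := a.integrable_pow_mul volume k

theorem exists_schwartz_oscInt_real (ζ : ℂ) {a : Euc n → ℝ} (ha : IsTestFun n a) :
    ∃ s : 𝓢(Euc n, ℝ), (∀ x, s x = oscInt ζ a x) ∧ ∀ (m : ℕ) (I : Fin m → Fin n) (x : Euc n),
      dirDeriv n m I s x =
        oscInt (ζ * (-(2 * π * Complex.I)) ^ m) (fun ξ => (∏ i, ξ (I i)) • a ξ) x := by
  have hc : HasCompactSupport (fun ξ => (a ξ : ℂ)) := ha.2.comp_left (g := Complex.ofReal) (by simp)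
  have hd : ContDiff ℝ (⊤ : ℕ∞) (fun ξ => (a ξ : ℂ)) := Complex.ofRealCLM.contDiff.comp ha.1
  set f : 𝓢(Euc n, ℂ) := hc.toSchwartzMap hd with hf
  have hfa : (f : Euc n → ℂ) = fun ξ => (a ξ : ℂ) := by ext ξ; simp [hf]
  set L : ℂ →L[ℝ] ℝ := Complex.reCLM ∘L (ContinuousLinearMap.mul ℝ ℂ ζ) with hL
  refine ⟨(𝓕 f).postcompCLM L, fun x => ?_, fun m I x => ?_⟩
  · rw [SchwartzMap.postcompCLM_apply, oscInt_eq_fourier ζ ha.integrable, ← hfa,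
      SchwartzMap.fourier_coe]
    simp [hL]
  · have e1 : (((𝓕 f).postcompCLM L : 𝓢(Euc n, ℝ)) : Euc n → ℝ) = L ∘ (𝓕 (f : Euc n → ℂ)) := by
      ext y; rw [SchwartzMap.postcompCLM_apply, SchwartzMap.fourier_coe]; rfl
    have hcd : ContDiff ℝ (⊤ : ℕ∞) (𝓕 (f : Euc n → ℂ)) := by
      rw [← SchwartzMap.fourier_coe]; exact (𝓕 f).smooth _
    have hp : ContDiff ℝ (⊤ : ℕ∞) (fun ξ : Euc n => ∏ i, ξ (I i)) := by
      apply contDiff_prod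
      intro i _
      fun_prop
    unfold dirDeriv
    rw [e1, L.iteratedFDeriv_comp_left hcd.contDiffAt (by exact_mod_cast le_top)]
    rw [Real.iteratedFDeriv_fourier (N := ⊤) (fun k _ => fourier_schwartz_moments f k)
      f.continuous.aestronglyMeasurable le_top]
    rw [oscInt_eq_fourier _ (ha.smul hp).integrable]
    simp only [ContinuousLinearMap.compContinuousMultilinearMap_coe, Function.comp_apply]
    rw [Real.fourier_continuousMultilinearMap_apply]
    · have e2 : (fun v => (VectorFourier.fourierPowSMulRight (innerSL ℝ) (f : Euc n → ℂ) v m)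
          fun i => stdVec n (I i)) =
          fun v => (-(2 * π * Complex.I)) ^ m • ((((∏ i, v (I i)) • a v : ℝ)) : ℂ) := by
        ext v
        rw [VectorFourier.fourierPowSMulRight_apply]
        congr 1
        simp [hfa, stdVec, innerSL_apply_apply ℝ, EuclideanSpace.inner_single_right]
      rw [e2]
      simp only [hL, ContinuousLinearMap.comp_apply, ContinuousLinearMap.mul_apply',
        Complex.reCLM_apply]
      congr 1
      rw [mul_assoc ζ]
      congr 1
      rw [Real.fourier_eq, Real.fourier_eq, ← integral_const_mul]
      congr 1
      ext v
      simp only [Circle.smul_def, smul_eq_mul]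
      ring
    · exact VectorFourier.integrable_fourierPowSMulRight _ (fourier_schwartz_moments f m)
        f.continuous.aestronglyMeasurable

theorem exists_schwartz_oscInt [FiniteDimensional ℝ E] (ζ : ℂ) {a : Euc n → E}
    (ha : IsTestFun n a) :
    ∃ s : 𝓢(Euc n, E), (∀ x, s x = oscInt ζ a x) ∧ ∀ (m : ℕ) (I : Fin m → Fin n) (x : Euc n),
      dirDeriv n m I s x =
        oscInt (ζ * (-(2 * π * Complex.I)) ^ m) (fun ξ => (∏ i, ξ (I i)) • a ξ) x := by
  set b := stdOrthonormalBasis ℝ E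
  have hb : ∀ k, IsTestFun n (fun ξ => ⟪b k, a ξ⟫) := fun k => ha.clm_comp (innerSL ℝ (b k))
  choose s hs hsd using fun k => exists_schwartz_oscInt_real ζ (hb k)
  set T : ∀ k, ℝ →L[ℝ] E := fun k => ContinuousLinearMap.toSpanSingleton ℝ (b k) with hT
  have key : ∀ (ζ' : ℂ) (c : Euc n → E), Integrable c → ∀ x,
      oscInt ζ' c x = ∑ k, T k (oscInt ζ' (fun ξ => ⟪b k, c ξ⟫) x) := by
    intro ζ' c hc x
    conv_lhs => rw [← b.sum_repr' (oscInt ζ' c x)]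
    refine Finset.sum_congr rfl fun k _ => ?_
    have := oscInt_clm_comp ζ' hc (innerSL ℝ (b k)) x
    simp only [innerSL_apply_apply ℝ] at this
    rw [this, hT, ContinuousLinearMap.toSpanSingleton_apply]
  refine ⟨∑ k, (s k).postcompCLM (T k), fun x => ?_, fun m I x => ?_⟩
  · rw [sum_apply, key _ _ ha.integrable]
    simp [hs]
  · have hp : ContDiff ℝ (⊤ : ℕ∞) (fun ξ : Euc n => ∏ i, ξ (I i)) := by
      apply contDiff_prod
      intro i _
      fun_prop
    have e1 : ((∑ k, (s k).postcompCLM (T k) : 𝓢(Euc n, E)) : Euc n → E) =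
        fun x => ∑ k, (T k ∘ s k) x := by
      ext y; simp
    rw [key _ _ (ha.smul hp).integrable]
    unfold dirDeriv at hsd ⊢
    rw [e1, iteratedFDeriv_fun_sum_apply (fun k _ => ((T k).contDiff.comp
      ((s k).smooth _)).contDiffAt)]
    rw [sum_apply]
    refine Finset.sum_congr rfl fun k _ => ?_
    rw [(T k).iteratedFDeriv_comp_left ((s k).smooth m).contDiffAt le_rfl]
    simp only [ContinuousLinearMap.compContinuousMultilinearMap_coe, Function.comp_apply]
    rw [hsd]
    simp only [inner_smul_right, smul_eq_mul]

end OscillatoryIntegrals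

section Cutoff

open scoped SchwartzMap

variable {n : ℕ}

/-- A smooth radial cutoff, equal to `1` on the unit ball. -/
noncomputable def radialCutoff (n : ℕ) (x : Euc n) : ℝ := Real.smoothTransition (2 - ‖x‖ ^ 2)

theorem radialCutoff_isTestFun (n : ℕ) : IsTestFun n (radialCutoff n) := by
  constructor
  · exact Real.smoothTransition.contDiff.comp (contDiff_const.sub (contDiff_norm_sq ℝ))
  · refine HasCompactSupport.intro (isCompact_closedBall 0 2) fun x hx => ?_
    rw [mem_closedBall, dist_zero_right, not_le] at hx
    apply Real.smoothTransition.zero_of_nonpos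
    nlinarith

theorem radialCutoff_of_norm_le {x : Euc n} (hx : ‖x‖ ≤ 1) : radialCutoff n x = 1 := by
  apply Real.smoothTransition.one_of_one_le
  nlinarith [norm_nonneg x]

theorem IsTestFun.bounded_iteratedFDeriv {F : Type*} [NormedAddCommGroup F] [NormedSpace ℝ F]
    {a : Euc n → F} (ha : IsTestFun n a) (m : ℕ) : ∃ C, ∀ x, ‖iteratedFDeriv ℝ m a x‖ ≤ C := by
  obtain ⟨C, -, hC⟩ := (ha.2.toSchwartzMap ha.1).decay 0 m
  refine ⟨C, fun x => ?_⟩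
  have := hC x
  simp only [pow_zero, one_mul] at this
  exact this

end Cutoff

section TestFunctions

open scoped SchwartzMap LineDeriv

variable {n : ℕ} {V W : Type*}
  [NormedAddCommGroup V] [InnerProductSpace ℝ V] [FiniteDimensional ℝ V]
  [NormedAddCommGroup W] [InnerProductSpace ℝ W] [FiniteDimensional ℝ W]

theorem norm_dirDeriv_le {F : Type*} [NormedAddCommGroup F] [NormedSpace ℝ F] {m : ℕ}
    (I : Fin m → Fin n) (φ : Euc n → F) (x : Euc n) :
    ‖dirDeriv n m I φ x‖ ≤ ‖iteratedFDeriv ℝ m φ x‖ := by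
  refine (ContinuousMultilinearMap.le_opNorm _ _).trans ?_
  simp [stdVec]

theorem continuous_dirDeriv {F : Type*} [NormedAddCommGroup F] [NormedSpace ℝ F] {m : ℕ}
    (I : Fin m → Fin n) {φ : Euc n → F} (hφ : ContDiff ℝ (⊤ : ℕ∞) φ) :
    Continuous (dirDeriv n m I φ) := by
  unfold dirDeriv
  have h := hφ.continuous_iteratedFDeriv (m := m) (by exact_mod_cast le_top)
  exact (ContinuousMultilinearMap.apply ℝ (fun _ : Fin m => Euc n) F
    (fun i => stdVec n (I i))).continuous.comp h

omit [FiniteDimensional ℝ W] in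
theorem cutoff_mul_bounded {φ : Euc n → W} (hφ : ContDiff ℝ (⊤ : ℕ∞) φ)
    (hb : ∀ m : ℕ, ∃ C, ∀ x, ‖iteratedFDeriv ℝ m φ x‖ ≤ C) (m : ℕ) :
    ∃ C, ∀ (c : ℝ), |c| ≤ 1 → ∀ x,
      ‖iteratedFDeriv ℝ m (fun y => radialCutoff n (c • y) • φ y) x‖ ≤ C := by
  choose B hB using hb
  choose D hD using (radialCutoff_isTestFun n).bounded_iteratedFDeriv
  refine ⟨∑ i ∈ Finset.range (m + 1), (m.choose i : ℝ) * D i * B (m - i), fun c hc x => ?_⟩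
  have hθ : ContDiff ℝ (⊤ : ℕ∞) (fun y : Euc n => radialCutoff n (c • y)) :=
    (radialCutoff_isTestFun n).1.comp (contDiff_const_smul c)
  refine (norm_iteratedFDeriv_smul_le hθ hφ x (n := m) (by exact_mod_cast le_top)).trans ?_
  refine Finset.sum_le_sum fun i _ => ?_
  have hD0 : 0 ≤ D i := (norm_nonneg _).trans (hD i 0)
  gcongr
  · rw [iteratedFDeriv_comp_const_smul c ((radialCutoff_isTestFun n).1.of_le
      (by exact_mod_cast le_top))]
    dsimp only
    rw [norm_smul, norm_pow, Real.norm_eq_abs]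
    calc |c| ^ i * _ ≤ 1 * D i := by
          gcongr
          · exact pow_le_one₀ (abs_nonneg c) hc
          · exact hD i _
      _ = D i := one_mul _
  · exact hB _ _

/-- The distributional identity extends to smooth test functions with bounded derivatives. -/
theorem HasDistribA.of_bounded {A : CoeffOp n n V W} {u : Euc n → V} {σ : Measure (Euc n)}
    {f : Euc n → W} (h : HasDistribA n n A u σ f) (hu : Integrable u) (hf : Integrable f σ)
    {φ : Euc n → W} (hφ : ContDiff ℝ (⊤ : ℕ∞) φ)
    (hb : ∀ m : ℕ, ∃ C, ∀ x, ‖iteratedFDeriv ℝ m φ x‖ ≤ C) :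
    ((-1 : ℝ) ^ n) * (∑ I : Fin n → Fin n,
        ∫ x, ⟪u x, LinearMap.adjoint (A I) (dirDeriv n n I φ x)⟫) = ∫ x, ⟪f x, φ x⟫ ∂σ := by
  set c : ℕ → ℝ := fun k => ((k : ℝ) + 1)⁻¹ with hc
  have hc0 : ∀ k, 0 < c k := fun k => by positivity
  have hc1 : ∀ k, |c k| ≤ 1 := fun k => by
    rw [abs_of_pos (hc0 k)]; exact inv_le_one_of_one_le₀ (by simp)
  have hlim : Tendsto c atTop (𝓝 0) := by
    have := tendsto_one_div_add_atTop_nhds_zero_nat (𝕜 := ℝ)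
    simpa [hc] using this
  set φk : ℕ → Euc n → W := fun k y => radialCutoff n (c k • y) • φ y with hφk
  have hθ : ∀ k, ContDiff ℝ (⊤ : ℕ∞) (fun y : Euc n => radialCutoff n (c k • y)) := fun k =>
    (radialCutoff_isTestFun n).1.comp (contDiff_const_smul (c k))
  have htest : ∀ k, IsTestFun n (φk k) := fun k =>
    ⟨(hθ k).smul hφ, HasCompactSupport.smul_right
      ((radialCutoff_isTestFun n).2.comp_smul (hc0 k).ne')⟩
  have hev : ∀ x : Euc n, ∀ᶠ k in atTop, φk k =ᶠ[𝓝 x] φ := by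
    intro x
    have h1 : Tendsto (fun k => c k * (‖x‖ + 1)) atTop (𝓝 (0 * (‖x‖ + 1))) :=
      hlim.mul_const _
    rw [zero_mul] at h1
    filter_upwards [h1.eventually (gt_mem_nhds one_pos)] with k hk
    filter_upwards [ball_mem_nhds x one_pos] with y hy
    have hy' : ‖y‖ ≤ ‖x‖ + 1 := by
      rw [mem_ball, dist_eq_norm] at hy
      have := norm_le_norm_add_norm_sub x y
      rw [norm_sub_rev] at this
      linarith
    have : radialCutoff n (c k • y) = 1 := by
      apply radialCutoff_of_norm_le
      rw [norm_smul, Real.norm_eq_abs, abs_of_pos (hc0 k)]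
      exact (mul_le_mul_of_nonneg_left hy' (hc0 k).le).trans hk.le
    simp [hφk, this]
  have hL : Tendsto (fun k => ((-1 : ℝ) ^ n) * (∑ I : Fin n → Fin n,
        ∫ x, ⟪u x, LinearMap.adjoint (A I) (dirDeriv n n I (φk k) x)⟫)) atTop
      (𝓝 (((-1 : ℝ) ^ n) * (∑ I : Fin n → Fin n,
        ∫ x, ⟪u x, LinearMap.adjoint (A I) (dirDeriv n n I φ x)⟫))) := by
    refine Tendsto.const_mul _ (tendsto_finsetSum _ fun I _ => ?_)
    obtain ⟨C, hC⟩ := cutoff_mul_bounded hφ hb n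
    set L : W →L[ℝ] V := LinearMap.toContinuousLinearMap (LinearMap.adjoint (A I)) with hLdef
    refine tendsto_integral_of_dominated_convergence (fun x => ‖u x‖ * (‖L‖ * C)) ?_ ?_ ?_ ?_
    · intro k
      refine hu.aestronglyMeasurable.inner ?_
      exact (L.continuous.comp (continuous_dirDeriv I (htest k).1)).aestronglyMeasurable
    · exact hu.norm.mul_const _
    · intro k
      filter_upwards with x
      refine (norm_inner_le_norm _ _).trans ?_
      gcongr
      refine (L.le_opNorm _).trans ?_
      gcongr
      exact (norm_dirDeriv_le _ _ _).trans (hC (c k) (hc1 k) x)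
    · filter_upwards with x
      refine tendsto_const_nhds.congr' ?_
      filter_upwards [hev x] with k hk
      have := (hk.iteratedFDeriv ℝ n).self_of_nhds
      simp only [dirDeriv, this]
  have hR : Tendsto (fun k => ∫ x, ⟪f x, φk k x⟫ ∂σ) atTop (𝓝 (∫ x, ⟪f x, φ x⟫ ∂σ)) := by
    obtain ⟨C, hC⟩ := cutoff_mul_bounded hφ hb 0
    refine tendsto_integral_of_dominated_convergence (fun x => ‖f x‖ * C) ?_ ?_ ?_ ?_
    · intro k
      exact hf.aestronglyMeasurable.inner (htest k).1.continuous.aestronglyMeasurable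
    · exact hf.norm.mul_const _
    · intro k
      filter_upwards with x
      refine (norm_inner_le_norm _ _).trans ?_
      gcongr
      simpa using hC (c k) (hc1 k) x
    · filter_upwards with x
      refine tendsto_const_nhds.congr' ?_
      filter_upwards [hev x] with k hk
      rw [hk.self_of_nhds]
  exact tendsto_nhds_unique (hL.congr fun k => h (φk k) (htest k)) hR

omit [FiniteDimensional ℝ V] in
theorem lineDerivOp_comm_schwartz (v w : Euc n) (s : 𝓢(Euc n, V)) : ∂_{v} (∂_{w} s) = ∂_{w} (∂_{v} s) := by
  ext x
  have hsm : ContDiff ℝ 2 s := s.smooth 2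
  have hd : ∀ y, DifferentiableAt ℝ (fderiv ℝ s) y := fun y =>
    (hsm.fderiv_right (m := 1) (by norm_num)).differentiable (by norm_num) y
  have key : ∀ a b : Euc n, (∂_{a} (∂_{b} s) : 𝓢(Euc n, V)) x = fderiv ℝ (fderiv ℝ s) x a b := by
    intro a b
    rw [SchwartzMap.lineDerivOp_apply_eq_fderiv]
    have : (⇑(∂_{b} s : 𝓢(Euc n, V)) : Euc n → V) = fun y => fderiv ℝ s y b := by
      ext y; exact SchwartzMap.lineDerivOp_apply_eq_fderiv ..
    rw [this, fderiv_clm_apply (hd x) (differentiableAt_const b)]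
    simp
  rw [key, key]
  exact (hsm.contDiffAt.isSymmSndFDerivAt (by simp)) v w

omit [FiniteDimensional ℝ V] in
theorem iteratedLineDerivOp_lineDerivOp_comm (m : ℕ) (v : Euc n) (w : Fin m → Euc n)
    (s : 𝓢(Euc n, V)) : ∂^{w} (∂_{v} s) = ∂_{v} (∂^{w} s) := by
  induction m with
  | zero => simp
  | succ m ih =>
    rw [LineDeriv.iteratedLineDerivOp_succ_left, LineDeriv.iteratedLineDerivOp_succ_left, ih,
      lineDerivOp_comm_schwartz]

omit [FiniteDimensional ℝ V] [FiniteDimensional ℝ W] in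
theorem integral_bilinear_iteratedLineDerivOp (m : ℕ) (v : Fin m → Euc n) (s : 𝓢(Euc n, V))
    (t : 𝓢(Euc n, W)) (L : V →L[ℝ] W →L[ℝ] ℝ) :
    ∫ x, L (s x) (∂^{v} t x) = (-1) ^ m * ∫ x, L (∂^{v} s x) (t x) := by
  induction m generalizing s t with
  | zero => simp
  | succ m ih =>
    rw [LineDeriv.iteratedLineDerivOp_succ_left,
      SchwartzMap.integral_bilinear_lineDerivOp_right_eq_neg_left, ih,
      LineDeriv.iteratedLineDerivOp_succ_left, iteratedLineDerivOp_lineDerivOp_comm]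
    ring

theorem hasDistribA_schwartz (A : CoeffOp n n V W) (s : 𝓢(Euc n, V)) :
    HasDistribA n n A s volume (Aapply n n A s) := by
  intro φ hφ
  set t : 𝓢(Euc n, W) := hφ.2.toSchwartzMap hφ.1
  have ht : ∀ x, t x = φ x := fun x => rfl
  have hd : ∀ I : Fin n → Fin n, ∀ x, dirDeriv n n I φ x = ∂^{fun i => stdVec n (I i)} t x :=
    fun I x => (SchwartzMap.iteratedLineDerivOp_eq_iteratedFDeriv (f := t)).symm
  have hs : ∀ I : Fin n → Fin n, ∀ x, dirDeriv n n I s x = ∂^{fun i => stdVec n (I i)} s x :=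
    fun I x => SchwartzMap.iteratedLineDerivOp_eq_iteratedFDeriv.symm
  let L : (Fin n → Fin n) → V →L[ℝ] W →L[ℝ] ℝ := fun I =>
    (innerSL ℝ (E := W)).comp (LinearMap.toContinuousLinearMap (A I))
  have hL : ∀ I v w, L I v w = ⟪A I v, w⟫ := fun I v w => rfl
  have key : ∀ I : Fin n → Fin n,
      ∫ x, ⟪s x, LinearMap.adjoint (A I) (dirDeriv n n I φ x)⟫ =
        (-1) ^ n * ∫ x, ⟪A I (dirDeriv n n I s x), φ x⟫ := by
    intro I
    have := integral_bilinear_iteratedLineDerivOp n (fun i => stdVec n (I i)) s t (L I)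
    simp only [hL, ← hd, ← hs, ht] at this
    rw [← this]
    simp only [LinearMap.adjoint_inner_right]
  have hint : ∀ I : Fin n → Fin n,
      Integrable (fun x => ⟪A I (dirDeriv n n I s x), φ x⟫) := by
    intro I
    have hc : Continuous fun x => ⟪A I (dirDeriv n n I s x), φ x⟫ :=
      (((LinearMap.toContinuousLinearMap (A I)).continuous.comp
        (continuous_dirDeriv I (s.smooth ⊤))).inner hφ.1.continuous)
    refine hc.integrable_of_hasCompactSupport ?_
    refine hφ.2.mono fun x hx => ?_
    rw [Function.mem_support] at hx ⊢
    contrapose! hx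
    rw [hx, inner_zero_right]
  simp only [key]
  rw [← Finset.mul_sum, ← mul_assoc, ← mul_pow]
  simp only [neg_mul_neg, mul_one, one_pow, one_mul, Aapply, sum_inner]
  rw [integral_finsetSum _ fun I _ => hint I]

end TestFunctions

section Symbol

variable {n : ℕ} {V W : Type*}
  [NormedAddCommGroup V] [InnerProductSpace ℝ V] [FiniteDimensional ℝ V]
  [NormedAddCommGroup W] [InnerProductSpace ℝ W] [FiniteDimensional ℝ W]

theorem linInv_comp_self {f : V →ₗ[ℝ] V}
    (hf : Function.Injective f) : linInv f ∘ₗ f = LinearMap.id := by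
  classical
  have hu : IsUnit (LinearMap.toMatrix (Module.finBasis ℝ V) (Module.finBasis ℝ V) f).det := by
    rw [LinearMap.det_toMatrix, isUnit_iff_ne_zero, ne_eq, LinearMap.det_eq_zero_iff_ker_ne_bot,
      not_not]
    exact LinearMap.ker_eq_bot.2 hf
  have h1 : linInv f ∘ₗ f = linInv f ∘ₗ
      Matrix.toLin (Module.finBasis ℝ V) (Module.finBasis ℝ V)
        (LinearMap.toMatrix (Module.finBasis ℝ V) (Module.finBasis ℝ V) f) := by
    rw [Matrix.toLin_toMatrix]
  rw [h1, linInv, ← Matrix.toLin_mul, Matrix.nonsing_inv_mul _ hu, Matrix.toLin_one]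

theorem self_comp_linInv {f : V →ₗ[ℝ] V}
    (hf : Function.Injective f) : f ∘ₗ linInv f = LinearMap.id :=
  mul_eq_one_comm.1 (linInv_comp_self hf)

/-- The symbol as a continuous linear map. -/
noncomputable def symCLM (A : CoeffOp n n V W) (ξ : Euc n) : V →L[ℝ] W :=
  ∑ I : Fin n → Fin n, (∏ i, ξ (I i)) • LinearMap.toContinuousLinearMap (A I)

/-- The adjoint of the symbol as a continuous linear map. -/
noncomputable def symAdjCLM (A : CoeffOp n n V W) (ξ : Euc n) : W →L[ℝ] V :=
  ∑ I : Fin n → Fin n,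
    (∏ i, ξ (I i)) • LinearMap.toContinuousLinearMap (LinearMap.adjoint (A I))

/-- `𝒜†[ξ]` as a continuous linear map. -/
noncomputable def dagCLM (A : CoeffOp n n V W) (ξ : Euc n) : W →L[ℝ] V :=
  LinearMap.toContinuousLinearMap (Adagger n n A ξ)

omit [FiniteDimensional ℝ W] in
theorem symCLM_apply (A : CoeffOp n n V W) (ξ : Euc n) (v : V) :
    symCLM A ξ v = symbolMap n n A ξ v := by
  simp [symCLM, symbolMap]

theorem symAdjCLM_apply (A : CoeffOp n n V W) (ξ : Euc n) (w : W) :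
    symAdjCLM A ξ w = LinearMap.adjoint (symbolMap n n A ξ) w := by
  refine ext_inner_right ℝ fun v => ?_
  rw [LinearMap.adjoint_inner_left]
  simp [symAdjCLM, symbolMap, sum_inner, inner_sum,
    real_inner_smul_left, real_inner_smul_right, LinearMap.adjoint_inner_left]

theorem inner_symAdjCLM (A : CoeffOp n n V W) (ξ : Euc n) (w : W) (v : V) :
    ⟪symAdjCLM A ξ w, v⟫ = ⟪w, symCLM A ξ v⟫ := by
  rw [symAdjCLM_apply, symCLM_apply, LinearMap.adjoint_inner_left]

theorem contDiff_prod_coord (I : Fin n → Fin n) :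
    ContDiff ℝ (⊤ : ℕ∞) (fun ξ : Euc n => ∏ i, ξ (I i)) :=
  contDiff_prod fun i _ => (EuclideanSpace.proj (𝕜 := ℝ) (I i)).contDiff

omit [FiniteDimensional ℝ W] in
theorem contDiff_symCLM (A : CoeffOp n n V W) : ContDiff ℝ (⊤ : ℕ∞) (symCLM A) :=
  ContDiff.sum fun I _ => (contDiff_prod_coord I).smul contDiff_const

theorem contDiff_symAdjCLM (A : CoeffOp n n V W) : ContDiff ℝ (⊤ : ℕ∞) (symAdjCLM A) :=
  ContDiff.sum fun I _ => (contDiff_prod_coord I).smul contDiff_const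

omit [FiniteDimensional ℝ W] in
theorem symCLM_smul (A : CoeffOp n n V W) (t : ℝ) (ξ : Euc n) :
    symCLM A (t • ξ) = t ^ n • symCLM A ξ := by
  simp [symCLM, Finset.prod_mul_distrib, mul_smul, Finset.smul_sum]

theorem symAdjCLM_smul (A : CoeffOp n n V W) (t : ℝ) (ξ : Euc n) :
    symAdjCLM A (t • ξ) = t ^ n • symAdjCLM A ξ := by
  simp [symAdjCLM, Finset.prod_mul_distrib, mul_smul, Finset.smul_sum]

theorem symAdj_comp_sym_injective {A : CoeffOp n n V W} (hell : IsElliptic n n A) {ξ : Euc n}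
    (hξ : ξ ≠ 0) : Function.Injective (symAdjCLM A ξ ∘L symCLM A ξ) := by
  refine (injective_iff_map_eq_zero _).2 fun v hv => ?_
  have h : ⟪symCLM A ξ v, symCLM A ξ v⟫ = 0 := by
    rw [← inner_symAdjCLM]
    rw [ContinuousLinearMap.comp_apply] at hv
    rw [hv, inner_zero_left]
  rw [inner_self_eq_zero, symCLM_apply] at h
  exact hell ξ hξ (by rw [h, map_zero])

theorem dagCLM_apply_eq (A : CoeffOp n n V W) (ξ : Euc n) (w : W) :
    dagCLM A ξ w = linInv ((symAdjCLM A ξ ∘L symCLM A ξ : V →L[ℝ] V) : V →ₗ[ℝ] V)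
      (symAdjCLM A ξ w) := by
  have : ((symAdjCLM A ξ ∘L symCLM A ξ : V →L[ℝ] V) : V →ₗ[ℝ] V) =
      LinearMap.adjoint (symbolMap n n A ξ) ∘ₗ symbolMap n n A ξ := by
    ext v; simp [symCLM_apply, symAdjCLM_apply]
  rw [this, symAdjCLM_apply]
  rfl

theorem dagCLM_symCLM {A : CoeffOp n n V W} (hell : IsElliptic n n A) {ξ : Euc n} (hξ : ξ ≠ 0)
    (v : V) : dagCLM A ξ (symCLM A ξ v) = v := by
  rw [dagCLM_apply_eq]
  exact LinearMap.congr_fun (linInv_comp_self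
    (f := ((symAdjCLM A ξ ∘L symCLM A ξ : V →L[ℝ] V) : V →ₗ[ℝ] V))
    (symAdj_comp_sym_injective hell hξ)) v

theorem symAdj_sym_dagCLM {A : CoeffOp n n V W} (hell : IsElliptic n n A) {ξ : Euc n}
    (hξ : ξ ≠ 0) (w : W) : symAdjCLM A ξ (symCLM A ξ (dagCLM A ξ w)) = symAdjCLM A ξ w := by
  rw [dagCLM_apply_eq]
  exact LinearMap.congr_fun (self_comp_linInv
    (f := ((symAdjCLM A ξ ∘L symCLM A ξ : V →L[ℝ] V) : V →ₗ[ℝ] V))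
    (symAdj_comp_sym_injective hell hξ)) (symAdjCLM A ξ w)

theorem symCLM_dagCLM_of_mem {A : CoeffOp n n V W} (hell : IsElliptic n n A) {ξ : Euc n}
    (hξ : ξ ≠ 0) {w : W} (hw : w ∈ LinearMap.range (symbolMap n n A ξ)) :
    symCLM A ξ (dagCLM A ξ w) = w := by
  obtain ⟨v, rfl⟩ := hw
  rw [← symCLM_apply, dagCLM_symCLM hell hξ]

theorem dagCLM_smul {A : CoeffOp n n V W} (hell : IsElliptic n n A) {ξ : Euc n}
    (hξ : ξ ≠ 0) {t : ℝ} (ht : t ≠ 0) : dagCLM A (t • ξ) = (t ^ n)⁻¹ • dagCLM A ξ := by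
  ext w
  apply symAdj_comp_sym_injective hell (smul_ne_zero ht hξ)
  have h1 := symAdj_sym_dagCLM hell (smul_ne_zero ht hξ) w
  rw [ContinuousLinearMap.comp_apply, h1, symCLM_smul, symAdjCLM_smul]
  simp only [ContinuousLinearMap.comp_apply, smul_apply, map_smul]
  rw [symAdj_sym_dagCLM hell hξ, smul_smul, smul_smul, inv_mul_cancel₀ (pow_ne_zero n ht),
    one_mul]

theorem contDiffAt_dagCLM {A : CoeffOp n n V W} (hell : IsElliptic n n A) {ξ : Euc n}
    (hξ : ξ ≠ 0) : ContDiffAt ℝ (⊤ : ℕ∞) (dagCLM A) ξ := by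
  have heq : dagCLM A =ᶠ[𝓝 ξ]
      fun η => ContinuousLinearMap.inverse (symAdjCLM A η ∘L symCLM A η) ∘L symAdjCLM A η := by
    filter_upwards [isOpen_ne.mem_nhds hξ] with η hη
    have hinj := symAdj_comp_sym_injective hell hη
    set e : V ≃L[ℝ] V := (LinearEquiv.ofInjectiveEndo
      ((symAdjCLM A η ∘L symCLM A η : V →L[ℝ] V) : V →ₗ[ℝ] V) hinj).toContinuousLinearEquiv
    have he : (symAdjCLM A η ∘L symCLM A η : V →L[ℝ] V) = (e : V →L[ℝ] V) := by ext v; rfl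
    rw [he, ContinuousLinearMap.inverse_equiv]
    ext w
    rw [ContinuousLinearMap.comp_apply, ← symAdj_sym_dagCLM hell hη w]
    exact (e.symm_apply_apply _).symm
  refine ContDiffAt.congr_of_eventuallyEq ?_ heq
  have hinj := symAdj_comp_sym_injective hell hξ
  set e : V ≃L[ℝ] V := (LinearEquiv.ofInjectiveEndo
    ((symAdjCLM A ξ ∘L symCLM A ξ : V →L[ℝ] V) : V →ₗ[ℝ] V) hinj).toContinuousLinearEquiv
  have he : (symAdjCLM A ξ ∘L symCLM A ξ : V →L[ℝ] V) = (e : V →L[ℝ] V) := by ext v; rfl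
  have hB : ContDiffAt ℝ (⊤ : ℕ∞) (fun η => symAdjCLM A η ∘L symCLM A η) ξ :=
    ((contDiff_symAdjCLM A).clm_comp (contDiff_symCLM A)).contDiffAt
  have hi : ContDiffAt ℝ (⊤ : ℕ∞) (ContinuousLinearMap.inverse (M := V) (M₂ := V) (R := ℝ))
      ((fun η => symAdjCLM A η ∘L symCLM A η) ξ) := by
    simp only [he]
    exact contDiffAt_map_inverse e
  exact (hi.comp ξ hB).clm_comp (contDiff_symAdjCLM A).contDiffAt

end Symbol

section Annulus

variable {n : ℕ}

/-- A smooth radial bump supported in an annulus; its dyadic dilates telescope. -/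
noncomputable def annularBump (n : ℕ) (ξ : Euc n) : ℝ :=
  radialCutoff n ((2 : ℝ)⁻¹ • ξ) - radialCutoff n ξ

theorem radialCutoff_dilate_isTestFun {c : ℝ} (hc : c ≠ 0) :
    IsTestFun n (fun ξ => radialCutoff n (c • ξ)) :=
  ⟨(radialCutoff_isTestFun n).1.comp (contDiff_const_smul c),
    (radialCutoff_isTestFun n).2.comp_smul hc⟩

theorem annularBump_isTestFun (n : ℕ) : IsTestFun n (annularBump n) :=
  ⟨(radialCutoff_dilate_isTestFun (by norm_num)).1.sub (radialCutoff_isTestFun n).1,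
    (radialCutoff_dilate_isTestFun (by norm_num)).2.sub (radialCutoff_isTestFun n).2⟩

theorem annularBump_eq_zero {ξ : Euc n} (h : ‖ξ‖ ≤ 1) : annularBump n ξ = 0 := by
  rw [annularBump, radialCutoff_of_norm_le h, radialCutoff_of_norm_le, sub_self]
  rw [norm_smul]; norm_num; linarith

theorem annularBump_nonneg (ξ : Euc n) : 0 ≤ annularBump n ξ := by
  rw [annularBump, sub_nonneg]
  apply Real.smoothTransition.monotone
  rw [norm_smul, mul_pow]
  norm_num
  nlinarith [sq_nonneg ‖ξ‖]

theorem annularBump_eq_one {ξ : Euc n} (h : ‖ξ‖ ^ 2 = 2) : annularBump n ξ = 1 := by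
  rw [annularBump, radialCutoff, radialCutoff, h, norm_smul, mul_pow, h,
    Real.smoothTransition.one_of_one_le, Real.smoothTransition.zero_of_nonpos] <;> norm_num

theorem annularBump_congr_norm {ξ η : Euc n} (h : ‖ξ‖ = ‖η‖) :
    annularBump n ξ = annularBump n η := by
  simp [annularBump, radialCutoff, norm_smul, h]

theorem sum_annularBump (ξ : Euc n) (l : ℝ) (N : ℕ) :
    ∑ j ∈ Finset.range N, annularBump n ((2 ^ j * l)⁻¹ • ξ) =
      radialCutoff n ((2 ^ N * l)⁻¹ • ξ) - radialCutoff n (l⁻¹ • ξ) := by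
  have := Finset.sum_range_sub (fun j => radialCutoff n ((2 ^ j * l)⁻¹ • ξ)) N
  simp only [pow_zero, one_mul] at this
  rw [← this]
  refine Finset.sum_congr rfl fun j _ => ?_
  rw [annularBump, smul_smul]
  congr 3
  rw [pow_succ, mul_comm (2 ^ j) 2, mul_assoc, mul_inv 2]

theorem isTestFun_smul_of_contDiffAt {E : Type*} [NormedAddCommGroup E] [NormedSpace ℝ E]
    {a : Euc n → E} (ha : ∀ ξ, ξ ≠ 0 → ContDiffAt ℝ (⊤ : ℕ∞) a ξ) {p : Euc n → ℝ}
    (hp : IsTestFun n p) {r : ℝ} (hr : 0 < r) (hp0 : ∀ ξ, ‖ξ‖ ≤ r → p ξ = 0) :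
    IsTestFun n (fun ξ => p ξ • a ξ) := by
  refine ⟨contDiff_iff_contDiffAt.2 fun ξ => ?_, hp.2.smul_right⟩
  rcases eq_or_ne ξ 0 with rfl | h
  · refine (contDiffAt_const (c := (0 : E))).congr_of_eventuallyEq ?_
    filter_upwards [ball_mem_nhds (0 : Euc n) hr] with η hη
    rw [hp0 η (by simpa using (mem_ball_zero_iff.1 hη).le), zero_smul]
  · exact hp.1.contDiffAt.smul (ha ξ h)

/-- A smooth function on `ℝ^n ∖ {0}` which is homogeneous of degree `-n`. -/
structure IsHomMult {E : Type*} [NormedAddCommGroup E] [NormedSpace ℝ E]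
    (a : Euc n → E) : Prop where
  contDiffAt : ∀ ξ, ξ ≠ 0 → ContDiffAt ℝ (⊤ : ℕ∞) a ξ
  hom : ∀ ξ, ξ ≠ 0 → ∀ t : ℝ, 0 < t → a (t • ξ) = (t ^ n)⁻¹ • a ξ

section IsHomMult

variable {E : Type*} [NormedAddCommGroup E] [NormedSpace ℝ E] {a : Euc n → E}

theorem IsHomMult.isTestFun_annular (ha : IsHomMult a) :
    IsTestFun n (fun ξ => annularBump n ξ • a ξ) :=
  isTestFun_smul_of_contDiffAt ha.contDiffAt (annularBump_isTestFun n) one_pos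
    fun _ h => annularBump_eq_zero h

theorem IsHomMult.isTestFun_shell (ha : IsHomMult a) {l : ℝ} (hl : 0 < l) (N : ℕ) :
    IsTestFun n (fun ξ => (radialCutoff n ((2 ^ N * l)⁻¹ • ξ) - radialCutoff n (l⁻¹ • ξ)) •
      a ξ) := by
  refine isTestFun_smul_of_contDiffAt ha.contDiffAt ?_ hl fun ξ h => ?_
  · exact ⟨(radialCutoff_dilate_isTestFun (by positivity)).1.sub
      (radialCutoff_dilate_isTestFun (by positivity)).1,
      (radialCutoff_dilate_isTestFun (by positivity)).2.sub
      (radialCutoff_dilate_isTestFun (by positivity)).2⟩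
  · rw [radialCutoff_of_norm_le, radialCutoff_of_norm_le, sub_self]
    · rw [norm_smul, Real.norm_of_nonneg (by positivity)]
      exact inv_mul_le_one_of_le₀ h hl.le
    · rw [norm_smul, Real.norm_of_nonneg (by positivity)]
      refine inv_mul_le_one_of_le₀ (h.trans ?_) (by positivity)
      exact le_mul_of_one_le_left hl.le (one_le_pow₀ one_le_two)

theorem IsHomMult.sum_oscInt {E : Type*} [NormedAddCommGroup E] [InnerProductSpace ℝ E]
    {a : Euc n → E} (ha : IsHomMult a) (ζ : ℂ) {l : ℝ} (hl : 0 < l) (N : ℕ)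
    (x : Euc n) :
    ∑ j ∈ Finset.range N, oscInt ζ (fun ξ => annularBump n ξ • a ξ) ((2 ^ j * l) • x) =
      oscInt ζ (fun ξ => (radialCutoff n ((2 ^ N * l)⁻¹ • ξ) - radialCutoff n (l⁻¹ • ξ)) •
        a ξ) x := by
  have hpos : ∀ j : ℕ, 0 < 2 ^ j * l := fun j => by positivity
  have key : ∀ j : ℕ, (fun ξ : Euc n => ((2 ^ j * l) ^ n)⁻¹ •
      (annularBump n ((2 ^ j * l)⁻¹ • ξ) • a ((2 ^ j * l)⁻¹ • ξ))) =
      fun ξ => annularBump n ((2 ^ j * l)⁻¹ • ξ) • a ξ := by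
    intro j
    ext ξ
    rcases eq_or_ne ξ 0 with rfl | h
    · simp [annularBump_eq_zero]
    · rw [ha.hom ξ h _ (inv_pos.2 (hpos j)), smul_comm, smul_smul (((2 ^ j * l) ^ n)⁻¹),
        inv_pow, inv_inv, inv_mul_cancel₀ (pow_ne_zero n (hpos j).ne'), one_smul]
  have hint : ∀ j : ℕ, Integrable (fun ξ => annularBump n ((2 ^ j * l)⁻¹ • ξ) • a ξ) := by
    intro j
    rw [← key j]
    exact Integrable.smul _ ((integrable_comp_smul_iff volume (fun ξ => annularBump n ξ • a ξ)
      (inv_pos.2 (hpos j)).ne').2 ha.isTestFun_annular.integrable)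
  simp_rw [oscInt_smul_arg ζ _ (hpos _), key]
  rw [← oscInt_sum _ _ fun j _ => hint j]
  simp_rw [← Finset.sum_smul, sum_annularBump]

end IsHomMult

end Annulus

section SphereMeasure

variable {n : ℕ}

/-- A finite measure concentrated on the unit sphere and invariant under linear isometries. -/
structure IsSphereInvariant (μ : Measure (Euc n)) : Prop where
  finite : IsFiniteMeasure μ
  conc : ∀ᵐ x ∂μ, ‖x‖ = 1
  inv : ∀ e : Euc n ≃ₗᵢ[ℝ] Euc n, μ.map e = μ

theorem IsSphereInvariant.charFun_eq {μ : Measure (Euc n)} (hμ : IsSphereInvariant μ)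
    {s t : Euc n} (h : ‖s‖ = ‖t‖) : charFun μ s = charFun μ t := by
  set e := (ℝ ∙ (s - t))ᗮ.reflection with he
  have hst : e s = t := Submodule.reflection_sub h
  rw [← hst, charFun_apply, charFun_apply]
  conv_rhs => rw [← hμ.inv e]
  rw [integral_map e.continuous.aemeasurable
    (Continuous.aestronglyMeasurable (by fun_prop))]
  simp only [LinearIsometryEquiv.inner_map_map]

theorem IsSphereInvariant.integral_charFun {μ ν : Measure (Euc n)} (hμ : IsSphereInvariant μ)
    (hν : IsSphereInvariant ν) (t : Euc n) :
    ∫ y, charFun μ (‖t‖ • y) ∂ν = (ν.real Set.univ : ℂ) * charFun μ t := by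
  have : ∀ᵐ y ∂ν, charFun μ (‖t‖ • y) = charFun μ t := by
    filter_upwards [hν.conc] with y hy
    exact hμ.charFun_eq (by rw [norm_smul, hy, norm_norm, mul_one])
  rw [integral_congr_ae this, integral_const, Complex.real_smul]

theorem IsSphereInvariant.smul_eq {μ ν : Measure (Euc n)} (hμ : IsSphereInvariant μ)
    (hν : IsSphereInvariant ν) : ν Set.univ • μ = μ Set.univ • ν := by
  have := hμ.finite
  have := hν.finite
  have : IsFiniteMeasure (ν Set.univ • μ) := μ.smul_finite (measure_ne_top _ _)
  have : IsFiniteMeasure (μ Set.univ • ν) := ν.smul_finite (measure_ne_top _ _)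
  apply Measure.ext_of_charFun
  ext t
  rw [charFun_apply, charFun_apply, integral_smul_measure, integral_smul_measure,
    ← charFun_apply, ← charFun_apply]
  have h1 := hμ.integral_charFun hν t
  have h2 := hν.integral_charFun hμ t
  simp only [charFun_apply] at h1 h2 ⊢
  rw [integral_integral_swap] at h1
  · simp only [Complex.real_smul]
    rw [Measure.real] at h1 h2
    rw [← h1, ← h2]
    refine integral_congr_ae (.of_forall fun x => ?_)
    refine integral_congr_ae (.of_forall fun y => ?_)
    simp only [real_inner_smul_right, real_inner_comm]
  · refine Integrable.of_bound (C := 1) ?_ ?_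
    · apply Continuous.aestronglyMeasurable
      fun_prop
    · filter_upwards with p
      exact (Complex.norm_exp_ofReal_mul_I _).le

theorem IsSphereInvariant.integral_eq_zero_iff {E : Type*} [NormedAddCommGroup E]
    [NormedSpace ℝ E] {μ ν : Measure (Euc n)} (hμ : IsSphereInvariant μ)
    (hν : IsSphereInvariant ν) (hμ0 : μ Set.univ ≠ 0) (hν0 : ν Set.univ ≠ 0) (g : Euc n → E) :
    ∫ x, g x ∂μ = 0 ↔ ∫ x, g x ∂ν = 0 := by
  have := hμ.finite
  have := hν.finite
  have h := congrArg (fun m : Measure (Euc n) => ∫ x, g x ∂m) (hμ.smul_eq hν)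
  simp only [integral_smul_measure] at h
  have a1 : (ν Set.univ).toReal ≠ 0 := ENNReal.toReal_ne_zero.2 ⟨hν0, measure_ne_top _ _⟩
  have a2 : (μ Set.univ).toReal ≠ 0 := ENNReal.toReal_ne_zero.2 ⟨hμ0, measure_ne_top _ _⟩
  constructor
  · intro h0
    rw [h0, smul_zero] at h
    exact (smul_eq_zero.1 h.symm).resolve_left a2
  · intro h0
    rw [h0, smul_zero] at h
    exact (smul_eq_zero.1 h).resolve_left a1

theorem isHomMult_norm_inv (n : ℕ) : IsHomMult (fun ξ : Euc n => (‖ξ‖ ^ n)⁻¹) where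
  contDiffAt ξ h := ((contDiffAt_norm ℝ h).pow n).inv (pow_ne_zero n (norm_ne_zero_iff.2 h))
  hom ξ _ t ht := by
    rw [norm_smul, Real.norm_of_nonneg ht.le, mul_pow, mul_inv, smul_eq_mul]

/-- The density of the radial measure whose projection to the sphere is used below. -/
noncomputable def radialDensity (n : ℕ) (ξ : Euc n) : ℝ := annularBump n ξ • (‖ξ‖ ^ n)⁻¹

theorem radialDensity_isTestFun (n : ℕ) : IsTestFun n (radialDensity n) :=
  (isHomMult_norm_inv n).isTestFun_annular

theorem radialDensity_nonneg (ξ : Euc n) : 0 ≤ radialDensity n ξ :=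
  smul_nonneg (annularBump_nonneg ξ) (by positivity)

/-- The projection to the unit sphere of a radial measure. -/
noncomputable def radialSphereMeasure (n : ℕ) : Measure (Euc n) :=
  ((volume : Measure (Euc n)).withDensity fun ξ => ENNReal.ofReal (radialDensity n ξ)).map
    fun ξ => ‖ξ‖⁻¹ • ξ

theorem measurable_radialDensity :
    Measurable fun ξ : Euc n => ENNReal.ofReal (radialDensity n ξ) :=
  (radialDensity_isTestFun n).1.continuous.measurable.ennreal_ofReal

theorem measurable_radial_proj : Measurable fun ξ : Euc n => ‖ξ‖⁻¹ • ξ :=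
  (measurable_norm.inv).smul measurable_id

theorem radialSphereMeasure_isSphereInvariant (n : ℕ) :
    IsSphereInvariant (radialSphereMeasure n) where
  finite := by
    have : IsFiniteMeasure ((volume : Measure (Euc n)).withDensity
        fun ξ => ENNReal.ofReal (radialDensity n ξ)) :=
      isFiniteMeasure_withDensity_ofReal (radialDensity_isTestFun n).integrable.2
    unfold radialSphereMeasure
    infer_instance
  conc := by
    unfold radialSphereMeasure
    rw [ae_map_iff measurable_radial_proj.aemeasurable
      (measurableSet_eq_fun measurable_norm measurable_const),
      ae_withDensity_iff measurable_radialDensity]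
    filter_upwards with ξ h
    have : ξ ≠ 0 := by
      rintro rfl
      simp [radialDensity, annularBump_eq_zero] at h
    rw [norm_smul, norm_inv, norm_norm, inv_mul_cancel₀ (norm_ne_zero_iff.2 this)]
  inv e := by
    unfold radialSphereMeasure
    rw [Measure.map_map e.continuous.measurable measurable_radial_proj]
    have h1 : (e ∘ fun ξ : Euc n => ‖ξ‖⁻¹ • ξ) = (fun ξ => ‖ξ‖⁻¹ • ξ) ∘ e := by
      ext1 ξ; simp
    rw [h1, ← Measure.map_map measurable_radial_proj e.continuous.measurable]
    congr 1
    ext s hs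
    rw [Measure.map_apply e.continuous.measurable hs, withDensity_apply _ hs,
      withDensity_apply _ (e.continuous.measurable hs),
      ← (e.measurePreserving).setLIntegral_comp_preimage hs measurable_radialDensity]
    simp [radialDensity, annularBump_congr_norm (e.norm_map _)]

theorem radialSphereMeasure_univ_ne_zero (hn : 1 ≤ n) :
    radialSphereMeasure n Set.univ ≠ 0 := by
  unfold radialSphereMeasure
  rw [Measure.map_apply measurable_radial_proj MeasurableSet.univ, Set.preimage_univ,
    withDensity_apply _ MeasurableSet.univ, Measure.restrict_univ, ne_eq,
    lintegral_eq_zero_iff measurable_radialDensity]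
  intro h
  have h' : radialDensity n =ᵐ[volume] 0 := by
    filter_upwards [h] with ξ hξ
    exact le_antisymm (ENNReal.ofReal_eq_zero.1 hξ) (radialDensity_nonneg ξ)
  have h2 := ((radialDensity_isTestFun n).1.continuous.ae_eq_iff_eq volume
    continuous_const).1 h'
  set η : Euc n := √2 • stdVec n ⟨0, hn⟩
  have hη : ‖η‖ = √2 := by simp [η, norm_smul, stdVec]
  have := congrFun h2 η
  simp only [radialDensity] at this
  rw [annularBump_eq_one (by rw [hη]; norm_num), one_smul, hη] at this
  exact absurd this (by positivity)

theorem integral_radialSphereMeasure {E : Type*} [NormedAddCommGroup E] [NormedSpace ℝ E]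
    {a : Euc n → E} (ha : IsHomMult a) :
    ∫ x, a x ∂(radialSphereMeasure n) = ∫ ξ, annularBump n ξ • a ξ := by
  have hinv := radialSphereMeasure_isSphereInvariant n
  have hmeas : AEStronglyMeasurable a (radialSphereMeasure n) := by
    have hr : (radialSphereMeasure n).restrict {x | x ≠ 0} = radialSphereMeasure n := by
      apply Measure.restrict_eq_self_of_ae_mem
      filter_upwards [hinv.conc] with x hx
      rintro rfl
      simp at hx
    rw [← hr]
    refine ContinuousOn.aestronglyMeasurable (fun x hx => ?_) isOpen_ne.measurableSet
    exact (ha.contDiffAt x hx).continuousAt.continuousWithinAt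
  unfold radialSphereMeasure at hmeas ⊢
  rw [integral_map measurable_radial_proj.aemeasurable hmeas,
    integral_withDensity_eq_integral_toReal_smul measurable_radialDensity
      (.of_forall fun _ => ENNReal.ofReal_lt_top)]
  refine integral_congr_ae (.of_forall fun ξ => ?_)
  simp only
  rw [ENNReal.toReal_ofReal (radialDensity_nonneg ξ), radialDensity]
  rcases eq_or_ne ξ 0 with rfl | h
  · simp [annularBump_eq_zero]
  · have h' := norm_pos_iff.2 h
    rw [ha.hom ξ h _ (inv_pos.2 h'), smul_assoc, smul_smul ((‖ξ‖ ^ n)⁻¹), inv_pow, inv_inv,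
      inv_mul_cancel₀ (pow_ne_zero n h'.ne'), one_smul]

end SphereMeasure

section HausdorffSphere

/-- The chart of a face of the cube, with the `i`-th coordinate equal to `s`. -/
noncomputable def cubeFace {m : ℕ} (i : Fin (m + 1)) (s : ℝ) (y : Fin m → ℝ) : Euc (m + 1) :=
  WithLp.toLp 2 (i.insertNth s y)

theorem contDiff_cubeFace {m : ℕ} (i : Fin (m + 1)) (s : ℝ) :
    ContDiff ℝ 1 (cubeFace i s) := by
  rw [contDiff_euclidean]
  intro j
  rcases Fin.eq_self_or_eq_succAbove i j with rfl | ⟨k, rfl⟩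
  · simpa [cubeFace] using contDiff_const
  · simpa [cubeFace] using contDiff_apply ℝ ℝ k

theorem hausdorffMeasure_sphere_lt_top {n : ℕ} (hn : 1 ≤ n) :
    μH[(n : ℝ) - 1] (sphere (0 : Euc n) 1) < ∞ := by
  obtain ⟨m, rfl⟩ : ∃ m, n = m + 1 := ⟨n - 1, by omega⟩
  have hd : ((m + 1 : ℕ) : ℝ) - 1 = m := by push_cast; ring
  rw [hd]
  set cube : Set (Fin m → ℝ) := closedBall 0 1 with hcube
  have hne : ∀ (i : Fin (m + 1)) (s : ℝ), s ≠ 0 → ∀ y, cubeFace i s y ≠ 0 := by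
    intro i s hs y h
    have := congrArg (fun z : Euc (m + 1) => z i) h
    simp [cubeFace] at this
    exact hs this
  have hfin : ∀ (i : Fin (m + 1)) (s : ℝ), s ≠ 0 →
      μH[(m : ℝ)] ((fun y => ‖cubeFace i s y‖⁻¹ • cubeFace i s y) '' cube) < ∞ := by
    intro i s hs
    have hsm : ContDiff ℝ 1 (fun y => ‖cubeFace i s y‖⁻¹ • cubeFace i s y) :=
      (((contDiff_cubeFace i s).norm ℝ (hne i s hs)).inv
        fun y => norm_ne_zero_iff.2 (hne i s hs y)).smul (contDiff_cubeFace i s)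
    obtain ⟨K, hK⟩ := hsm.contDiffOn.exists_lipschitzOnWith one_ne_zero
      (convex_closedBall (0 : Fin m → ℝ) 1) (isCompact_closedBall _ _)
    refine (hK.hausdorffMeasure_image_le (Nat.cast_nonneg m)).trans_lt ?_
    refine ENNReal.mul_lt_top (ENNReal.rpow_lt_top_of_nonneg (Nat.cast_nonneg m)
      ENNReal.coe_ne_top) ?_
    have := hausdorffMeasure_pi_real (ι := Fin m)
    rw [Fintype.card_fin] at this
    rw [this]
    exact measure_closedBall_lt_top
  have hsub : sphere (0 : Euc (m + 1)) 1 ⊆ ⋃ i : Fin (m + 1), ⋃ b : Bool,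
      (fun y => ‖cubeFace i (cond b 1 (-1)) y‖⁻¹ • cubeFace i (cond b 1 (-1)) y) '' cube := by
    intro x hx
    rw [mem_sphere_zero_iff_norm] at hx
    obtain ⟨i, -, hi⟩ := Finset.exists_max_image Finset.univ (fun i => |x i|)
      ⟨0, Finset.mem_univ _⟩
    have hxi : 0 < |x i| := by
      by_contra! h
      have : x = 0 := by
        ext j
        simpa using (hi j (Finset.mem_univ j)).trans h
      rw [this, norm_zero] at hx
      exact zero_ne_one hx
    set b : Bool := decide (0 < x i) with hb
    have hs : (cond b 1 (-1) : ℝ) = |x i|⁻¹ * x i := by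
      by_cases h : 0 < x i
      · have : b = true := by simp [hb, h]
        rw [this, abs_of_pos h]
        simp [h.ne']
      · have : b = false := by simp [hb, h]
        have h' : x i < 0 := lt_of_le_of_ne (not_lt.1 h) (abs_pos.1 hxi)
        rw [this, abs_of_neg h']
        rw [inv_neg, neg_mul, inv_mul_cancel₀ h'.ne]
        rfl
    have hface : cubeFace i (cond b 1 (-1)) (fun k => |x i|⁻¹ * x (i.succAbove k)) =
        |x i|⁻¹ • x := by
      ext j
      rcases Fin.eq_self_or_eq_succAbove i j with rfl | ⟨k, rfl⟩
      · simp [cubeFace, hs]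
      · simp [cubeFace]
    simp only [Set.mem_iUnion]
    refine ⟨i, b, fun k => |x i|⁻¹ * x (i.succAbove k), ?_, ?_⟩
    · rw [hcube, mem_closedBall_zero_iff, pi_norm_le_iff_of_nonneg zero_le_one]
      intro k
      rw [norm_mul, norm_inv, Real.norm_eq_abs, abs_abs, Real.norm_eq_abs]
      exact inv_mul_le_one_of_le₀ (hi _ (Finset.mem_univ _)) hxi.le
    · simp only
      rw [hface, norm_smul, hx, mul_one, norm_inv, Real.norm_eq_abs, abs_abs, inv_inv, smul_smul,
        mul_inv_cancel₀ hxi.ne', one_smul]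
  refine (measure_mono hsub).trans_lt ?_
  refine (measure_iUnion_fintype_le _ _).trans_lt (ENNReal.sum_lt_top.2 fun i _ => ?_)
  refine (measure_iUnion_fintype_le _ _).trans_lt (ENNReal.sum_lt_top.2 fun b _ => hfin i _ ?_)
  cases b <;> norm_num

theorem hausdorffMeasure_sphere_ne_zero {n : ℕ} (hn : 1 ≤ n) :
    μH[(n : ℝ) - 1] (sphere (0 : Euc n) 1) ≠ 0 := by
  obtain ⟨m, rfl⟩ : ∃ m, n = m + 1 := ⟨n - 1, by omega⟩
  have hd : ((m + 1 : ℕ) : ℝ) - 1 = m := by push_cast; ring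
  rw [hd]
  set p : Euc (m + 1) → (Fin m → ℝ) := fun x k => x (Fin.succ k) with hp
  have hlip : LipschitzWith 1 p := by
    refine LipschitzWith.of_dist_le_mul fun x y => ?_
    rw [NNReal.coe_one, one_mul, dist_pi_le_iff dist_nonneg]
    intro k
    rw [Real.dist_eq, dist_eq_norm]
    exact PiLp.norm_apply_le (x - y) (Fin.succ k)
  have hr : (0 : ℝ) < 1 / (m + 1) := by positivity
  have hsub : ball (0 : Fin m → ℝ) (1 / (m + 1)) ⊆ p '' sphere (0 : Euc (m + 1)) 1 := by
    intro y hy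
    rw [mem_ball_zero_iff] at hy
    have hsum : ∑ k, y k ^ 2 ≤ 1 := by
      have hk : ∀ k, y k ^ 2 ≤ 1 / (m + 1) := fun k => by
        have h1 : |y k| ≤ 1 / (m + 1) := (norm_le_pi_norm y k).trans hy.le
        have h2 : (1 : ℝ) / (m + 1) ≤ 1 := by
          rw [div_le_one (by positivity)]; linarith [(Nat.cast_nonneg m : (0 : ℝ) ≤ m)]
        calc y k ^ 2 = |y k| * |y k| := by rw [← sq, sq_abs]
          _ ≤ 1 / (m + 1) * 1 := mul_le_mul h1 (h1.trans h2) (abs_nonneg _) hr.le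
          _ = _ := mul_one _
      calc ∑ k, y k ^ 2 ≤ ∑ _k : Fin m, (1 : ℝ) / (m + 1) := Finset.sum_le_sum fun k _ => hk k
        _ = m / (m + 1) := by simp [div_eq_mul_inv]
        _ ≤ 1 := by rw [div_le_one (by positivity)]; linarith
    refine ⟨cubeFace 0 (√(1 - ∑ k, y k ^ 2)) y, ?_, ?_⟩
    · rw [mem_sphere_zero_iff_norm, EuclideanSpace.norm_eq, Real.sqrt_eq_one,
        Fin.sum_univ_succ]
      simp only [cubeFace, Real.norm_eq_abs, sq_abs, Fin.insertNth_zero', Fin.cons_zero,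
        Fin.cons_succ]
      rw [Real.sq_sqrt (by linarith)]
      ring
    · ext k
      simp [hp, cubeFace]
  intro h0
  have h1 := hlip.hausdorffMeasure_image_le (Nat.cast_nonneg m) (sphere (0 : Euc (m + 1)) 1)
  rw [h0, mul_zero, nonpos_iff_eq_zero] at h1
  have h2 := measure_mono_null hsub h1
  have := hausdorffMeasure_pi_real (ι := Fin m)
  rw [Fintype.card_fin] at this
  rw [this] at h2
  exact (measure_ball_pos volume _ hr).ne' h2

theorem hausdorffMeasure_sphere_isSphereInvariant {n : ℕ} (hn : 1 ≤ n) :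
    IsSphereInvariant ((μH[(n : ℝ) - 1]).restrict (sphere (0 : Euc n) 1)) where
  finite := ⟨by rw [Measure.restrict_apply_univ]; exact hausdorffMeasure_sphere_lt_top hn⟩
  conc := by
    filter_upwards [ae_restrict_mem isClosed_sphere.measurableSet] with x hx
    exact mem_sphere_zero_iff_norm.1 hx
  inv e := by
    have h1 := Measure.restrict_map (μ := μH[(n : ℝ) - 1]) e.continuous.measurable
      (isClosed_sphere (x := (0 : Euc n)) (ε := 1)).measurableSet
    have h2 : e ⁻¹' (sphere 0 1) = sphere 0 1 := by ext x; simp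
    have h3 : (μH[(n : ℝ) - 1] : Measure (Euc n)).map e = μH[(n : ℝ) - 1] :=
      e.toIsometryEquiv.map_hausdorffMeasure _
    rw [h2, h3] at h1
    exact h1.symm

theorem integral_sphere_eq_zero_iff {n : ℕ} (hn : 1 ≤ n) {E : Type*} [NormedAddCommGroup E]
    [NormedSpace ℝ E] {a : Euc n → E} (ha : IsHomMult a) :
    ∫ ξ in sphere (0 : Euc n) 1, a ξ ∂(μH[(n : ℝ) - 1]) = 0 ↔
      ∫ ξ, annularBump n ξ • a ξ = 0 := by
  rw [← integral_radialSphereMeasure ha]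
  refine (hausdorffMeasure_sphere_isSphereInvariant hn).integral_eq_zero_iff
    (radialSphereMeasure_isSphereInvariant n) ?_ (radialSphereMeasure_univ_ne_zero hn) a
  rw [Measure.restrict_apply_univ]
  exact hausdorffMeasure_sphere_ne_zero hn

end HausdorffSphere

section WeakCancellation

variable {n : ℕ} {V W : Type*}
  [NormedAddCommGroup V] [InnerProductSpace ℝ V] [FiniteDimensional ℝ V]
  [NormedAddCommGroup W] [InnerProductSpace ℝ W] [FiniteDimensional ℝ W]

theorem isHomMult_dagCLM {A : CoeffOp n n V W} (hell : IsElliptic n n A) :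
    IsHomMult (dagCLM A) where
  contDiffAt _ h := contDiffAt_dagCLM hell h
  hom _ h _ ht := dagCLM_smul hell h ht.ne'

theorem IsHomMult.clm_comp {E E' : Type*} [NormedAddCommGroup E] [NormedSpace ℝ E]
    [NormedAddCommGroup E'] [NormedSpace ℝ E'] {a : Euc n → E} (ha : IsHomMult a)
    (L : E →L[ℝ] E') : IsHomMult (fun ξ => L (a ξ)) where
  contDiffAt ξ h := L.contDiff.contDiffAt.comp ξ (ha.contDiffAt ξ h)
  hom ξ h t ht := by rw [ha.hom ξ h t ht, map_smul]

theorem IsHomMult.clm_apply {E E' : Type*} [NormedAddCommGroup E] [NormedSpace ℝ E]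
    [NormedAddCommGroup E'] [NormedSpace ℝ E'] {a : Euc n → E →L[ℝ] E'} (ha : IsHomMult a)
    (w : E) : IsHomMult (fun ξ => a ξ w) :=
  ha.clm_comp (ContinuousLinearMap.apply ℝ E' w)

theorem isWeaklyCanceling_iff (hn : 1 ≤ n) {A : CoeffOp n n V W} (hell : IsElliptic n n A) :
    IsWeaklyCanceling n n A ↔
      ∀ w : W, (∀ ξ : Euc n, ξ ≠ 0 → w ∈ LinearMap.range (symbolMap n n A ξ)) →
        ∫ ξ, annularBump n ξ • dagCLM A ξ w = 0 := by
  have key : ∀ w : W, (∀ J : Fin (n - n) → Fin n, (∫ ξ in sphere (0 : Euc n) 1,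
      (∏ i, ξ (J i)) • (Adagger n n A ξ w) ∂(μH[(n : ℝ) - 1])) = 0) ↔
      ∫ ξ, annularBump n ξ • dagCLM A ξ w = 0 := by
    intro w
    rw [← integral_sphere_eq_zero_iff hn ((isHomMult_dagCLM hell).clm_apply w)]
    have hempty : IsEmpty (Fin (n - n)) := by rw [Nat.sub_self]; infer_instance
    simp only [Finset.univ_eq_empty, Finset.prod_empty, one_smul]
    exact ⟨fun h => h hempty.elim, fun h _ => h⟩
  have hrange : ∀ w : W, (∀ ξ ∈ sphere (0 : Euc n) 1,
      w ∈ LinearMap.range (symbolMap n n A ξ)) ↔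
      ∀ ξ : Euc n, ξ ≠ 0 → w ∈ LinearMap.range (symbolMap n n A ξ) := by
    intro w
    constructor
    · intro h ξ hξ
      have hξ' := norm_pos_iff.2 hξ
      obtain ⟨v, hv⟩ := h (‖ξ‖⁻¹ • ξ) (by
        rw [mem_sphere_zero_iff_norm, norm_smul, norm_inv, norm_norm, inv_mul_cancel₀ hξ'.ne'])
      rw [← symCLM_apply, symCLM_smul] at hv
      exact ⟨(‖ξ‖⁻¹) ^ n • v, by rw [map_smul, ← symCLM_apply, ← hv]; rfl⟩
    · intro h ξ hξ
      refine h ξ ?_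
      rintro rfl
      simp at hξ
  unfold IsWeaklyCanceling
  simp only [key, hrange]

end WeakCancellation

section CutoffKernel

open scoped SchwartzMap

variable {n : ℕ}

/-- The inverse of the symbol `(-2πi)^n` of differentiation under the Fourier transform. -/
noncomputable def derivConst (n : ℕ) : ℂ := ((-(2 * Real.pi * Complex.I)) ^ n)⁻¹

theorem derivConst_mul (n : ℕ) : derivConst n * (-(2 * Real.pi * Complex.I)) ^ n = 1 := by
  apply inv_mul_cancel₀
  apply pow_ne_zero
  simp [Real.pi_ne_zero]

theorem derivConst_re_ne_zero (h : Even n) : (derivConst n).re ≠ 0 := by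
  obtain ⟨k, rfl⟩ := h
  have : derivConst (k + k) = (((-(4 * Real.pi ^ 2)) ^ k : ℝ) : ℂ)⁻¹ := by
    rw [derivConst, ← two_mul, pow_mul]
    congr 1
    push_cast
    congr 1
    rw [neg_sq, mul_pow, mul_pow, Complex.I_sq]
    ring
  rw [this, ← Complex.ofReal_inv, Complex.ofReal_re]
  apply inv_ne_zero
  apply pow_ne_zero
  apply neg_ne_zero.2
  positivity

theorem sum_dirDeriv_oscInt {E E' : Type*} [NormedAddCommGroup E] [InnerProductSpace ℝ E]
    [FiniteDimensional ℝ E] [NormedAddCommGroup E'] [InnerProductSpace ℝ E']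
    [FiniteDimensional ℝ E'] {a : Euc n → E} (ha : IsTestFun n a) {s : 𝓢(Euc n, E)}
    (hs : ∀ (m : ℕ) (I : Fin m → Fin n) (x : Euc n), dirDeriv n m I s x =
      oscInt (derivConst n * (-(2 * Real.pi * Complex.I)) ^ m)
        (fun ξ => (∏ i, ξ (I i)) • a ξ) x)
    (B : (Fin n → Fin n) → E →L[ℝ] E') (x : Euc n) :
    ∑ I : Fin n → Fin n, B I (dirDeriv n n I s x) =
      oscInt 1 (fun ξ => ∑ I : Fin n → Fin n, (∏ i, ξ (I i)) • B I (a ξ)) x := by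
  have hI : ∀ I : Fin n → Fin n, IsTestFun n (fun ξ => (∏ i, ξ (I i)) • a ξ) := fun I =>
    ha.smul (contDiff_prod_coord I)
  rw [oscInt_sum]
  · refine Finset.sum_congr rfl fun I _ => ?_
    rw [hs, derivConst_mul, oscInt_clm_comp 1 (hI I).integrable]
    simp only [map_smul]
  · intro I _
    simpa only [map_smul] using ((hI I).clm_comp (B I)).integrable

/-- The Fourier transform of the radial cutoff. -/
noncomputable def cutKer (n : ℕ) (x : Euc n) : ℝ := oscInt 1 (radialCutoff n) x

/-- The `L¹`-normalised dilate of `cutKer`. -/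
noncomputable def cutKerDil (n : ℕ) (l : ℝ) (x : Euc n) : ℝ := l ^ n * cutKer n (l • x)

theorem cutKerDil_eq {l : ℝ} (hl : 0 < l) (x : Euc n) :
    cutKerDil n l x = oscInt 1 (fun ξ => radialCutoff n (l⁻¹ • ξ)) x := by
  rw [cutKerDil, cutKer, oscInt_smul_arg 1 _ hl]
  simp only [smul_eq_mul]
  unfold oscInt
  rw [← integral_const_mul]
  refine integral_congr_ae (.of_forall fun ξ => ?_)
  simp only [smul_eq_mul]
  have : l ^ n ≠ 0 := by positivity
  field_simp

theorem exists_schwartz_cutKer (n : ℕ) : ∃ s : 𝓢(Euc n, ℝ), ⇑s = cutKer n := by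
  obtain ⟨s, hs, -⟩ := exists_schwartz_oscInt (1 : ℂ) (radialCutoff_isTestFun n)
  exact ⟨s, funext hs⟩

theorem continuous_cutKer : Continuous (cutKer n) := by
  obtain ⟨s, hs⟩ := exists_schwartz_cutKer n
  exact hs ▸ s.continuous

theorem integrable_cutKer : Integrable (cutKer n) := by
  obtain ⟨s, hs⟩ := exists_schwartz_cutKer n
  exact hs ▸ s.integrable

theorem continuous_cutKerDil (l : ℝ) : Continuous (cutKerDil n l) :=
  continuous_const.mul (continuous_cutKer.comp (continuous_const_smul l))

theorem integrable_cutKerDil {l : ℝ} (hl : 0 < l) : Integrable (cutKerDil n l) :=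
  ((integrable_comp_smul_iff volume (cutKer n) hl.ne').2 integrable_cutKer).const_mul _

theorem integral_abs_cutKerDil {l : ℝ} (hl : 0 < l) :
    ∫ x, |cutKerDil n l x| = ∫ x : Euc n, |cutKer n x| := by
  have h := Measure.integral_comp_smul (volume : Measure (Euc n)) (fun x => |cutKer n x|) l
  have hp : 0 < l ^ n := by positivity
  simp only [cutKerDil, abs_mul, integral_const_mul]
  rw [h, finrank_euclideanSpace, Fintype.card_fin, abs_of_pos hp, abs_of_pos (inv_pos.2 hp),
    smul_eq_mul, mul_inv_cancel_left₀ hp.ne']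

theorem oscInt_shell_smul {E : Type*} [NormedAddCommGroup E] [InnerProductSpace ℝ E]
    [FiniteDimensional ℝ E] {l : ℝ} (hl : 0 < l) (N : ℕ) (w : E) (x : Euc n) :
    oscInt 1 (fun ξ => (radialCutoff n ((2 ^ N * l)⁻¹ • ξ) - radialCutoff n (l⁻¹ • ξ)) • w) x =
      (cutKerDil n (2 ^ N * l) x - cutKerDil n l x) • w := by
  have h1 : Integrable (fun ξ : Euc n => radialCutoff n ((2 ^ N * l)⁻¹ • ξ)) :=
    (radialCutoff_dilate_isTestFun (by positivity)).integrable
  have h2 : Integrable (fun ξ : Euc n => radialCutoff n (l⁻¹ • ξ)) :=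
    (radialCutoff_dilate_isTestFun (by positivity)).integrable
  rw [cutKerDil_eq (by positivity), cutKerDil_eq hl]
  unfold oscInt
  rw [← integral_sub (oscInt_integrable 1 h1 x) (oscInt_integrable 1 h2 x),
    ← integral_smul_const]
  refine integral_congr_ae (.of_forall fun ξ => ?_)
  simp only [smul_eq_mul, ← mul_sub, mul_smul]

end CutoffKernel

section Necessity

open scoped SchwartzMap

variable {n : ℕ} {V W : Type*}
  [NormedAddCommGroup V] [InnerProductSpace ℝ V] [FiniteDimensional ℝ V]
  [NormedAddCommGroup W] [InnerProductSpace ℝ W] [FiniteDimensional ℝ W]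

theorem integral_annular_dagCLM_of_odd {A : CoeffOp n n V W} (hell : IsElliptic n n A)
    (hodd : Odd n) (w : W) : ∫ ξ, annularBump n ξ • dagCLM A ξ w = 0 := by
  have h := integral_neg_eq_self (fun ξ => annularBump n ξ • dagCLM A ξ w) volume
  have h2 : ∀ ξ : Euc n, annularBump n (-ξ) • dagCLM A (-ξ) w =
      -(annularBump n ξ • dagCLM A ξ w) := by
    intro ξ
    rw [annularBump_congr_norm (norm_neg ξ)]
    rcases eq_or_ne ξ 0 with rfl | hξ
    · simp [annularBump_eq_zero]
    · have := dagCLM_smul hell hξ (t := -1) (by norm_num)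
      rw [neg_one_smul, hodd.neg_one_pow] at this
      rw [this]
      simp [inv_neg]
  simp only [h2] at h
  rw [integral_neg] at h
  rw [neg_eq_iff_add_eq_zero, ← two_smul ℝ] at h
  exact (smul_eq_zero.1 h).resolve_left two_ne_zero

theorem exists_schwartz_log_growth (hn : 1 ≤ n) {A : CoeffOp n n V W} (hell : IsElliptic n n A)
    {w : W} (hw : ∀ ξ : Euc n, ξ ≠ 0 → w ∈ LinearMap.range (symbolMap n n A ξ)) :
    ∃ K : ℝ, ∀ N : ℕ, ∃ s : 𝓢(Euc n, V),
      s 0 = (N : ℝ) • (derivConst n).re • ∫ ξ, annularBump n ξ • dagCLM A ξ w ∧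
      ∫ x, ‖s x‖ ≤ K ∧ Continuous (Aapply n n A s) ∧ Integrable (Aapply n n A s) ∧
      ∫ x, ‖Aapply n n A s x‖ ≤ K := by
  have hM := (isHomMult_dagCLM hell).clm_apply w
  obtain ⟨P, hP, -⟩ := exists_schwartz_oscInt (derivConst n) hM.isTestFun_annular
  have hpos : (0 : ℝ) < 1 := one_pos
  set K1 := 2 * ∫ x, ‖P x‖
  set K2 := (2 * ∫ x : Euc n, |cutKer n x|) * ‖w‖
  refine ⟨max K1 K2, fun N => ?_⟩
  obtain ⟨s, hs, hsd⟩ := exists_schwartz_oscInt (derivConst n) (hM.isTestFun_shell hpos N)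
  have hsum : ∀ x, s x = ∑ j ∈ Finset.range N, P ((2 : ℝ) ^ j • x) := by
    intro x
    rw [hs, ← hM.sum_oscInt _ hpos]
    simp only [mul_one, hP]
  have hA : ∀ x, Aapply n n A s x = (cutKerDil n (2 ^ N * 1) x - cutKerDil n 1 x) • w := by
    intro x
    rw [← oscInt_shell_smul hpos]
    have := sum_dirDeriv_oscInt (hM.isTestFun_shell hpos N) hsd
      (fun I => LinearMap.toContinuousLinearMap (A I)) x
    simp only [LinearMap.coe_toContinuousLinearMap'] at this
    rw [Aapply, this]
    congr 1
    ext ξ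
    rcases eq_or_ne ξ 0 with rfl | hξ
    · simp
    · have h1 := symCLM_dagCLM_of_mem hell hξ (hw ξ hξ)
      rw [symCLM_apply] at h1
      simp only [map_smul, smul_comm _ (radialCutoff n _ - radialCutoff n _)]
      rw [← Finset.smul_sum]
      congr 1
      conv_rhs => rw [← h1]
      simp [symbolMap]
  have hc2 : (0 : ℝ) < 2 ^ N * 1 := by positivity
  have hi1 := integrable_cutKerDil (n := n) hc2
  have hi2 := integrable_cutKerDil (n := n) hpos
  refine ⟨s, ?_, ?_, ?_, ?_, ?_⟩
  · rw [hsum]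
    simp only [smul_zero, Finset.sum_const, Finset.card_range]
    rw [hP, oscInt_zero, Nat.cast_smul_eq_nsmul]
  · refine le_trans ?_ (le_max_left _ _)
    have hPi : ∀ j : ℕ, Integrable (fun x => ‖P ((2 : ℝ) ^ j • x)‖) := fun j =>
      ((integrable_comp_smul_iff volume (fun x => P x) (by positivity)).2 P.integrable).norm
    have hP0 : 0 ≤ ∫ x, ‖P x‖ := integral_nonneg fun _ => norm_nonneg _
    calc ∫ x, ‖s x‖ ≤ ∫ x, ∑ j ∈ Finset.range N, ‖P ((2 : ℝ) ^ j • x)‖ := by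
          refine integral_mono s.integrable.norm (integrable_finsetSum _ fun j _ => hPi j) ?_
          intro x
          simp only [hsum]
          exact norm_sum_le _ _
      _ = ∑ j ∈ Finset.range N, ∫ x, ‖P ((2 : ℝ) ^ j • x)‖ :=
          integral_finsetSum _ fun j _ => hPi j
      _ ≤ ∑ j ∈ Finset.range N, (1 / 2 : ℝ) ^ j * ∫ x, ‖P x‖ := by
          refine Finset.sum_le_sum fun j _ => ?_
          rw [Measure.integral_comp_smul (volume : Measure (Euc n)) (fun x => ‖P x‖),
            finrank_euclideanSpace, Fintype.card_fin, smul_eq_mul, abs_of_pos (by positivity)]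
          gcongr
          rw [one_div, inv_pow]
          gcongr
          rw [← pow_mul]
          exact pow_le_pow_right₀ one_le_two (Nat.le_mul_of_pos_right j hn)
      _ ≤ K1 := by
          rw [← Finset.sum_mul]
          exact mul_le_mul_of_nonneg_right (sum_geometric_two_le N) hP0
  · exact (continuous_congr hA).2
      (((continuous_cutKerDil _).sub (continuous_cutKerDil _)).smul continuous_const)
  · rw [funext hA]
    exact (hi1.sub hi2).smul_const w
  · refine le_trans ?_ (le_max_right _ _)
    simp only [hA, norm_smul, integral_mul_const, Real.norm_eq_abs]
    refine mul_le_mul_of_nonneg_right ?_ (norm_nonneg w)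
    calc ∫ x, |cutKerDil n (2 ^ N * 1) x - cutKerDil n 1 x|
        ≤ ∫ x, (|cutKerDil n (2 ^ N * 1) x| + |cutKerDil n 1 x|) :=
          integral_mono (hi1.sub hi2).abs (hi1.abs.add hi2.abs) fun x => abs_sub _ _
      _ = _ := by
          rw [integral_add hi1.abs hi2.abs, integral_abs_cutKerDil hc2,
            integral_abs_cutKerDil hpos, two_mul]

theorem isWeaklyCanceling_of_bound (hn : 1 ≤ n) {A : CoeffOp n n V W} (hell : IsElliptic n n A)
    (h : ∃ C : ℝ, ∀ s : 𝓢(Euc n, V), Continuous (Aapply n n A s) →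
      Integrable (Aapply n n A s) →
      ‖s 0‖ ≤ C * ((∫ x, ‖s x‖) + ∫ x, ‖Aapply n n A s x‖)) : IsWeaklyCanceling n n A := by
  rw [isWeaklyCanceling_iff hn hell]
  intro w hw
  rcases Nat.even_or_odd n with he | ho
  · obtain ⟨C, hC⟩ := h
    obtain ⟨K, hK⟩ := exists_schwartz_log_growth hn hell hw
    set z := (derivConst n).re • ∫ ξ, annularBump n ξ • dagCLM A ξ w with hz
    have hb : ∀ N : ℕ, N * ‖z‖ ≤ |C| * (K + K) := by
      intro N
      obtain ⟨s, h0, h1, h2, h3, h4⟩ := hK N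
      have := hC s h2 h3
      rw [h0, norm_smul, Real.norm_natCast] at this
      refine this.trans ?_
      have hnn : 0 ≤ (∫ x, ‖s x‖) + ∫ x, ‖Aapply n n A s x‖ :=
        add_nonneg (integral_nonneg fun _ => norm_nonneg _)
          (integral_nonneg fun _ => norm_nonneg _)
      calc _ ≤ |C| * ((∫ x, ‖s x‖) + ∫ x, ‖Aapply n n A s x‖) :=
            mul_le_mul_of_nonneg_right (le_abs_self C) hnn
        _ ≤ _ := by gcongr
    have hz0 : z = 0 := by
      by_contra hne
      obtain ⟨N, hN⟩ := exists_nat_gt (|C| * (K + K) / ‖z‖)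
      rw [div_lt_iff₀ (norm_pos_iff.2 hne)] at hN
      exact absurd (hb N) (not_le.2 hN)
    exact (smul_eq_zero.1 hz0).resolve_left (derivConst_re_ne_zero he)
  · exact integral_annular_dagCLM_of_odd hell ho w

end Necessity

section NecessityStatements

open scoped SchwartzMap

variable {n : ℕ} {V W : Type*}
  [NormedAddCommGroup V] [InnerProductSpace ℝ V] [FiniteDimensional ℝ V]
  [NormedAddCommGroup W] [InnerProductSpace ℝ W] [FiniteDimensional ℝ W]

theorem isWeaklyCanceling_of_embedding (hn : 1 ≤ n) {A : CoeffOp n n V W}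
    (hell : IsElliptic n n A)
    (h : ∃ C : ℝ, ∀ (u : Euc n → V) (g : Euc n → W),
      Integrable u volume → Integrable g volume → HasDistribA n n A u volume g →
        ∃ v : Euc n → V, Continuous v ∧ Tendsto v (cocompact (Euc n)) (𝓝 0) ∧
          v =ᵐ[volume] u ∧ ∀ x, ‖v x‖ ≤ C * ((∫ y, ‖u y‖) + ∫ y, ‖g y‖)) :
    IsWeaklyCanceling n n A := by
  obtain ⟨C, hC⟩ := h
  refine isWeaklyCanceling_of_bound hn hell ⟨C, fun s _ hi => ?_⟩
  obtain ⟨v, hv, -, hae, hb⟩ := hC s _ s.integrable hi (hasDistribA_schwartz A s)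
  rw [hv.ae_eq_iff_eq volume s.continuous] at hae
  rw [← hae]
  simpa only [hae] using hb 0

omit [InnerProductSpace ℝ W] [FiniteDimensional ℝ W] in
theorem isFiniteMeasure_withDensity_norm {g : Euc n → W} (hg : Integrable g) :
    IsFiniteMeasure (volume.withDensity fun x => ENNReal.ofReal ‖g x‖) :=
  isFiniteMeasure_withDensity_ofReal hg.norm.2

omit [InnerProductSpace ℝ W] [FiniteDimensional ℝ W] in
theorem withDensity_norm_univ {g : Euc n → W} (hg : Integrable g) :
    ((volume.withDensity fun x => ENNReal.ofReal ‖g x‖) Set.univ).toReal = ∫ x, ‖g x‖ := by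
  rw [withDensity_apply _ MeasurableSet.univ, Measure.restrict_univ,
    integral_eq_lintegral_of_nonneg_ae (.of_forall fun _ => norm_nonneg _)
      hg.norm.aestronglyMeasurable]

omit [FiniteDimensional ℝ W] in
theorem integral_withDensity_norm {g : Euc n → W} (hg : Continuous g) (φ : Euc n → W) :
    ∫ x, ⟪‖g x‖⁻¹ • g x, φ x⟫ ∂(volume.withDensity fun x => ENNReal.ofReal ‖g x‖) =
      ∫ x, ⟪g x, φ x⟫ := by
  rw [integral_withDensity_eq_integral_toReal_smul hg.norm.measurable.ennreal_ofReal
    (.of_forall fun _ => ENNReal.ofReal_lt_top)]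
  refine integral_congr_ae (.of_forall fun x => ?_)
  simp only [ENNReal.toReal_ofReal (norm_nonneg _), real_inner_smul_left, smul_eq_mul]
  rcases eq_or_ne (g x) 0 with h | h
  · simp [h]
  · rw [mul_inv_cancel_left₀ (norm_ne_zero_iff.2 h)]

theorem isWeaklyCanceling_of_bounded (hn : 1 ≤ n) {A : CoeffOp n n V W}
    (hell : IsElliptic n n A)
    (h : ∃ c : ℝ, ∀ (u : Euc n → V) (σ : Measure (Euc n)) (f : Euc n → W),
      Integrable u volume → IsFiniteMeasure σ → Integrable f σ →
        (∀ᵐ x ∂σ, ‖f x‖ = 1) → HasDistribA n n A u σ f →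
        ∀ᵐ x ∂(volume : Measure (Euc n)), ‖u x‖ ≤ c * (σ Set.univ).toReal) :
    IsWeaklyCanceling n n A := by
  obtain ⟨c, hc⟩ := h
  refine isWeaklyCanceling_of_bound hn hell ⟨|c|, fun s hcont hi => ?_⟩
  set g := Aapply n n A s
  have hfin := isFiniteMeasure_withDensity_norm hi
  set σ := (volume : Measure (Euc n)).withDensity fun x => ENNReal.ofReal ‖g x‖ with hσ
  have hone : ∀ᵐ x ∂σ, ‖‖g x‖⁻¹ • g x‖ = 1 := by
    rw [hσ, ae_withDensity_iff hcont.norm.measurable.ennreal_ofReal]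
    filter_upwards with x hx
    have : ‖g x‖ ≠ 0 := fun h0 => hx (by rw [h0, ENNReal.ofReal_zero])
    rw [norm_smul, norm_inv, norm_norm, inv_mul_cancel₀ this]
  have hint : Integrable (fun x => ‖g x‖⁻¹ • g x) σ := by
    refine Integrable.of_bound (C := 1) ?_ (hone.mono fun x hx => hx.le)
    exact (hcont.norm.measurable.inv.aestronglyMeasurable).smul hcont.aestronglyMeasurable
  have hdist : HasDistribA n n A s σ (fun x => ‖g x‖⁻¹ • g x) := by
    intro φ hφ
    rw [hasDistribA_schwartz A s φ hφ, hσ, integral_withDensity_norm hcont]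
  have hae := hc s σ _ s.integrable hfin hint hone hdist
  rw [hσ, withDensity_norm_univ hi] at hae
  have hcl : IsClosed {x | ‖s x‖ ≤ c * ∫ x, ‖g x‖} :=
    isClosed_le s.continuous.norm continuous_const
  have hden : Dense {x | ‖s x‖ ≤ c * ∫ x, ‖g x‖} := Measure.dense_of_ae hae
  have h0 : (0 : Euc n) ∈ {x | ‖s x‖ ≤ c * ∫ x, ‖g x‖} := by
    rw [← hcl.closure_eq]; exact hden 0
  refine le_trans h0 ?_
  have h1 : 0 ≤ ∫ x, ‖s x‖ := integral_nonneg fun _ => norm_nonneg _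
  have h2 : 0 ≤ ∫ x, ‖g x‖ := integral_nonneg fun _ => norm_nonneg _
  calc c * ∫ x, ‖g x‖ ≤ |c| * ∫ x, ‖g x‖ := mul_le_mul_of_nonneg_right (le_abs_self c) h2
    _ ≤ _ := mul_le_mul_of_nonneg_left (le_add_of_nonneg_left h1) (abs_nonneg c)

end NecessityStatements

section ModifiedMultiplier

open scoped SchwartzMap

variable {n : ℕ} {V W : Type*}
  [NormedAddCommGroup V] [InnerProductSpace ℝ V] [FiniteDimensional ℝ V]
  [NormedAddCommGroup W] [InnerProductSpace ℝ W] [FiniteDimensional ℝ W]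

/-- The projection onto the orthogonal complement of the image of the symbol. -/
noncomputable def coProj (A : CoeffOp n n V W) (ξ : Euc n) : W →L[ℝ] W :=
  ContinuousLinearMap.id ℝ W - symCLM A ξ ∘L dagCLM A ξ

theorem coProj_apply (A : CoeffOp n n V W) (ξ : Euc n) (w : W) :
    coProj A ξ w = w - symCLM A ξ (dagCLM A ξ w) := rfl

theorem coProj_symCLM {A : CoeffOp n n V W} (hell : IsElliptic n n A) {ξ : Euc n} (hξ : ξ ≠ 0)
    (v : V) : coProj A ξ (symCLM A ξ v) = 0 := by
  rw [coProj_apply, dagCLM_symCLM hell hξ, sub_self]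

theorem inner_coProj {A : CoeffOp n n V W} (hell : IsElliptic n n A) {ξ : Euc n} (hξ : ξ ≠ 0)
    (w : W) : ⟪w, coProj A ξ w⟫ = ‖coProj A ξ w‖ ^ 2 := by
  rw [← real_inner_self_eq_norm_sq]
  nth_rw 2 [coProj_apply]
  rw [inner_sub_left, real_inner_comm, ← sub_eq_zero, sub_sub_cancel, real_inner_comm,
    ← inner_symAdjCLM, coProj_apply, map_sub, symAdj_sym_dagCLM hell hξ, sub_self, inner_zero_left]

theorem coProj_smul {A : CoeffOp n n V W} (hell : IsElliptic n n A) {ξ : Euc n} (hξ : ξ ≠ 0)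
    {t : ℝ} (ht : t ≠ 0) : coProj A (t • ξ) = coProj A ξ := by
  ext w
  rw [coProj_apply, coProj_apply, dagCLM_smul hell hξ ht, symCLM_smul]
  simp only [smul_apply, map_smul]
  rw [smul_smul, inv_mul_cancel₀ (pow_ne_zero n ht), one_smul]

theorem isHomMult_coProj {A : CoeffOp n n V W} (hell : IsElliptic n n A) :
    IsHomMult (fun ξ : Euc n => (‖ξ‖ ^ n)⁻¹ • coProj A ξ) where
  contDiffAt ξ h := ((isHomMult_norm_inv n).contDiffAt ξ h).smul
    (contDiffAt_const.sub ((contDiff_symCLM A).contDiffAt.clm_comp (contDiffAt_dagCLM hell h)))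
  hom ξ h t ht := by
    rw [coProj_smul hell h ht.ne', (isHomMult_norm_inv n).hom ξ h t ht, smul_assoc]

omit [FiniteDimensional ℝ V] [FiniteDimensional ℝ W] in
theorem LinearMap.exists_comp_eq_of_ker_le {S : W →ₗ[ℝ] W} {L : W →ₗ[ℝ] V}
    (h : LinearMap.ker S ≤ LinearMap.ker L) : ∃ T : W →ₗ[ℝ] V, T ∘ₗ S = L := by
  obtain ⟨T, hT⟩ := LinearMap.exists_extend (p := LinearMap.range S)
    ((LinearMap.ker S).liftQ L h ∘ₗ S.quotKerEquivRange.symm.toLinearMap)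
  refine ⟨T, LinearMap.ext fun w => ?_⟩
  have := LinearMap.congr_fun hT (S.quotKerEquivRange (Submodule.Quotient.mk w))
  simpa using this

theorem IsHomMult.sub {E : Type*} [NormedAddCommGroup E] [NormedSpace ℝ E] {a b : Euc n → E}
    (ha : IsHomMult a) (hb : IsHomMult b) : IsHomMult (fun ξ => a ξ - b ξ) where
  contDiffAt ξ h := (ha.contDiffAt ξ h).sub (hb.contDiffAt ξ h)
  hom ξ h t ht := by rw [ha.hom ξ h t ht, hb.hom ξ h t ht, smul_sub]

theorem exists_modified_multiplier (hn : 1 ≤ n) {A : CoeffOp n n V W}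
    (hell : IsElliptic n n A) (hwc : IsWeaklyCanceling n n A) :
    ∃ M : Euc n → W →L[ℝ] V, IsHomMult M ∧ (∀ ξ, ξ ≠ 0 → ∀ v, M ξ (symCLM A ξ v) = v) ∧
      ∀ w, ∫ ξ, annularBump n ξ • M ξ w = 0 := by
  rw [isWeaklyCanceling_iff hn hell] at hwc
  set D : Euc n → W →L[ℝ] W := fun ξ => (‖ξ‖ ^ n)⁻¹ • coProj A ξ with hD
  have hDm : IsHomMult D := isHomMult_coProj hell
  set S : W →L[ℝ] W := ∫ ξ, annularBump n ξ • D ξ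
  set L : W →L[ℝ] V := ∫ ξ, annularBump n ξ • dagCLM A ξ
  have hS : ∀ w, S w = ∫ ξ, annularBump n ξ • D ξ w := fun w =>
    ContinuousLinearMap.integral_apply hDm.isTestFun_annular.integrable w
  have hL : ∀ w, L w = ∫ ξ, annularBump n ξ • dagCLM A ξ w := fun w =>
    ContinuousLinearMap.integral_apply (isHomMult_dagCLM hell).isTestFun_annular.integrable w
  have hker : LinearMap.ker (S : W →ₗ[ℝ] W) ≤ LinearMap.ker (L : W →ₗ[ℝ] V) := by
    intro w hw
    have hw' : S w = 0 := hw
    change L w = 0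
    rw [hL]
    apply hwc
    have htf := (hDm.clm_apply w).isTestFun_annular.clm_comp (innerSL ℝ w)
    have h1 : ∫ ξ, ⟪w, annularBump n ξ • D ξ w⟫ = 0 := by
      have := (innerSL ℝ w).integral_comp_comm (hDm.clm_apply w).isTestFun_annular.integrable
      simp only [innerSL_apply_apply] at this
      rw [this, ← hS, hw', inner_zero_right]
    have hval : ∀ ξ, ⟪w, annularBump n ξ • D ξ w⟫ =
        annularBump n ξ * ((‖ξ‖ ^ n)⁻¹ * ‖coProj A ξ w‖ ^ 2) := by
      intro ξ
      rcases eq_or_ne ξ 0 with rfl | hξ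
      · simp [annularBump_eq_zero]
      · rw [real_inner_smul_right, hD]
        simp only [smul_apply]
        rw [real_inner_smul_right, inner_coProj hell hξ]
    have hnn : ∀ ξ, 0 ≤ ⟪w, annularBump n ξ • D ξ w⟫ := fun ξ => by
      rw [hval]
      have := annularBump_nonneg ξ
      positivity
    have h2 := (integral_eq_zero_iff_of_nonneg hnn htf.integrable).1 h1
    have h3 := (htf.1.continuous.ae_eq_iff_eq volume continuous_const).1 h2
    intro ξ hξ
    have hpos := norm_pos_iff.2 hξ
    set t : ℝ := √2 / ‖ξ‖ with ht
    have ht0 : t ≠ 0 := by positivity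
    have hnt : ‖t • ξ‖ = √2 := by
      rw [norm_smul, Real.norm_of_nonneg (by positivity), ht, div_mul_cancel₀ _ hpos.ne']
    have h4 := (hval (t • ξ)).symm.trans (congrFun h3 (t • ξ))
    rw [annularBump_eq_one (by rw [hnt]; norm_num), one_mul, coProj_smul hell hξ ht0, hnt] at h4
    have h5 : coProj A ξ w = 0 := by
      have := (mul_eq_zero.1 h4).resolve_left (by positivity)
      simpa using this
    rw [coProj_apply, sub_eq_zero] at h5
    exact ⟨dagCLM A ξ w, by rw [← symCLM_apply, ← h5]⟩
  obtain ⟨T, hT⟩ := LinearMap.exists_comp_eq_of_ker_le hker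
  set Tc : W →L[ℝ] V := LinearMap.toContinuousLinearMap T
  have hTm : IsHomMult (fun ξ => Tc ∘L D ξ) :=
    hDm.clm_comp (ContinuousLinearMap.compL ℝ W W V Tc)
  refine ⟨fun ξ => dagCLM A ξ - Tc ∘L D ξ, (isHomMult_dagCLM hell).sub hTm, ?_, ?_⟩
  · intro ξ hξ v
    simp only [sub_apply, ContinuousLinearMap.comp_apply, hD, smul_apply,
      coProj_symCLM hell hξ, smul_zero, map_zero, sub_zero, dagCLM_symCLM hell hξ]
  · intro w
    have e : ∀ ξ, annularBump n ξ • (dagCLM A ξ - Tc ∘L D ξ) w =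
        annularBump n ξ • dagCLM A ξ w - Tc (annularBump n ξ • D ξ w) := by
      intro ξ
      simp only [sub_apply, ContinuousLinearMap.comp_apply, smul_sub, map_smul]
    have hi := (hDm.clm_apply w).isTestFun_annular.integrable
    simp only [e]
    rw [integral_sub ((isHomMult_dagCLM hell).clm_apply w).isTestFun_annular.integrable
      (Tc.integrable_comp hi), Tc.integral_comp_comm hi, ← hL, ← hS, sub_eq_zero]
    exact (LinearMap.congr_fun hT w).symm

/-- The map `M ↦ M* v`. -/
noncomputable def adjApply (v : V) : (W →L[ℝ] V) →L[ℝ] W :=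
  ∑ k, ContinuousLinearMap.toSpanSingleton ℝ (stdOrthonormalBasis ℝ W k) ∘L innerSL ℝ v ∘L
    ContinuousLinearMap.apply ℝ V (stdOrthonormalBasis ℝ W k)

omit [FiniteDimensional ℝ V] in
theorem inner_adjApply (v : V) (M : W →L[ℝ] V) (w : W) :
    ⟪adjApply v M, w⟫ = ⟪v, M w⟫ := by
  conv_rhs => rw [← (stdOrthonormalBasis ℝ W).sum_repr w]
  simp only [adjApply, sum_apply, sum_inner, map_sum, inner_sum, map_smul]
  refine Finset.sum_congr rfl fun k _ => ?_
  simp [real_inner_smul_left, real_inner_smul_right, OrthonormalBasis.repr_apply_apply, mul_comm]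

theorem norm_schwartz_le_telescope {E : Type*} [NormedAddCommGroup E] [NormedSpace ℝ E]
    (P : 𝓢(Euc n, E)) (h0 : P 0 = 0) : ∃ C, 0 ≤ C ∧ ∀ z,
      ‖P z‖ ≤ C * ((1 + ‖z‖)⁻¹ - (1 + 2 * ‖z‖)⁻¹) := by
  obtain ⟨C0, hC0, h0'⟩ := P.decay 0 0
  obtain ⟨C1, hC1, h1⟩ := P.decay 0 1
  obtain ⟨C2, hC2, h2⟩ := P.decay 1 0
  simp only [pow_zero, one_mul, norm_iteratedFDeriv_zero, pow_one] at h0' h1 h2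
  have hlip : ∀ z, ‖P z‖ ≤ C1 * ‖z‖ := by
    intro z
    have := Convex.norm_image_sub_le_of_norm_fderiv_le (𝕜 := ℝ) (f := P) (C := C1)
      (fun x _ => P.differentiableAt) (fun x _ => by
        rw [← norm_iteratedFDeriv_one]; exact h1 x) convex_univ
      (Set.mem_univ 0) (Set.mem_univ z)
    simpa [h0] using this
  refine ⟨C1 + 3 * C0 + 2 * C2, by positivity, fun z => ?_⟩
  set s := ‖z‖ with hs
  have hs0 : 0 ≤ s := norm_nonneg z
  have e : (1 + s)⁻¹ - (1 + 2 * s)⁻¹ = s / ((1 + s) * (1 + 2 * s)) := by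
    field_simp
    ring
  rw [e, mul_div_assoc', le_div_iff₀ (by positivity)]
  nlinarith [hlip z, mul_le_mul_of_nonneg_right (h0' z) hs0, mul_le_mul_of_nonneg_right (h2 z) hs0]

theorem exists_dual_kernel {A : CoeffOp n n V W} {M : Euc n → W →L[ℝ] V} (hM : IsHomMult M)
    (hinv : ∀ ξ, ξ ≠ 0 → ∀ v, M ξ (symCLM A ξ v) = v)
    (hcan : ∀ w, ∫ ξ, annularBump n ξ • M ξ w = 0) (v : V) :
    ∃ C, 0 ≤ C ∧ ∀ l : ℝ, 0 < l → ∀ N : ℕ, ∃ s : 𝓢(Euc n, W),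
      (∀ x, ‖s x‖ ≤ C * (1 + l * ‖x‖)⁻¹) ∧
      ∀ x, ∑ I : Fin n → Fin n, LinearMap.adjoint (A I) (dirDeriv n n I s x) =
        (cutKerDil n (2 ^ N * l) x - cutKerDil n l x) • v := by
  have ha : IsHomMult (fun ξ => adjApply v (M ξ)) := hM.clm_comp (adjApply v)
  obtain ⟨P, hP, -⟩ := exists_schwartz_oscInt (derivConst n) ha.isTestFun_annular
  have hP0 : P 0 = 0 := by
    rw [hP, oscInt_zero]
    have : ∫ ξ, annularBump n ξ • adjApply v (M ξ) = 0 := by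
      refine ext_inner_left ℝ fun w => ?_
      have h1 := (innerSL ℝ w).integral_comp_comm ha.isTestFun_annular.integrable
      have h2 := (innerSL ℝ v).integral_comp_comm (hM.clm_apply w).isTestFun_annular.integrable
      simp only [innerSL_apply_apply, real_inner_smul_right] at h1 h2
      rw [← h1, inner_zero_right]
      have e : ∀ ξ, annularBump n ξ * ⟪w, adjApply v (M ξ)⟫ = annularBump n ξ * ⟪v, M ξ w⟫ :=
        fun ξ => by rw [real_inner_comm, inner_adjApply]
      simp only [e]
      rw [h2, hcan, inner_zero_right]
    rw [this, smul_zero]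
  obtain ⟨C, hC0, hC⟩ := norm_schwartz_le_telescope P hP0
  refine ⟨C, hC0, fun l hl N => ?_⟩
  obtain ⟨s, hs, hsd⟩ := exists_schwartz_oscInt (derivConst n) (ha.isTestFun_shell hl N)
  refine ⟨s, fun x => ?_, fun x => ?_⟩
  · rw [hs, ← ha.sum_oscInt _ hl]
    simp only [← hP]
    have hn0 : 0 ≤ l * ‖x‖ := by positivity
    have hterm : ∀ j : ℕ, ‖P ((2 ^ j * l) • x)‖ ≤
        C * ((1 + 2 ^ j * (l * ‖x‖))⁻¹ - (1 + 2 ^ (j + 1) * (l * ‖x‖))⁻¹) := by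
      intro j
      refine (hC _).trans_eq ?_
      rw [norm_smul, Real.norm_of_nonneg (by positivity), pow_succ]
      congr 4 <;> ring
    calc _ ≤ ∑ j ∈ Finset.range N,
          C * ((1 + 2 ^ j * (l * ‖x‖))⁻¹ - (1 + 2 ^ (j + 1) * (l * ‖x‖))⁻¹) :=
        (norm_sum_le _ _).trans (Finset.sum_le_sum fun j _ => hterm j)
      _ = C * ((1 + l * ‖x‖)⁻¹ - (1 + 2 ^ N * (l * ‖x‖))⁻¹) := by
        rw [← Finset.mul_sum,
          Finset.sum_range_sub' (fun j : ℕ => (1 + 2 ^ j * (l * ‖x‖))⁻¹)]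
        simp
      _ ≤ _ := by
        refine mul_le_mul_of_nonneg_left (sub_le_self _ (by positivity)) hC0
  · rw [← oscInt_shell_smul hl]
    have := sum_dirDeriv_oscInt (ha.isTestFun_shell hl N) hsd
      (fun I => LinearMap.toContinuousLinearMap (LinearMap.adjoint (A I))) x
    simp only [LinearMap.coe_toContinuousLinearMap'] at this
    rw [this]
    congr 1
    ext ξ
    rcases eq_or_ne ξ 0 with rfl | hξ
    · simp
    · have h1 : symAdjCLM A ξ (adjApply v (M ξ)) = v := by
        refine ext_inner_right ℝ fun v' => ?_
        rw [inner_symAdjCLM, inner_adjApply, hinv ξ hξ]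
      simp only [map_smul, smul_comm _ (radialCutoff n _ - radialCutoff n _)]
      rw [← Finset.smul_sum]
      congr 1
      conv_rhs => rw [← h1]
      simp [symAdjCLM]

end ModifiedMultiplier

section Smoothing

open scoped SchwartzMap

variable {n : ℕ} {V W : Type*}
  [NormedAddCommGroup V] [InnerProductSpace ℝ V] [FiniteDimensional ℝ V]
  [NormedAddCommGroup W] [InnerProductSpace ℝ W] [FiniteDimensional ℝ W]

theorem integral_cutKer : ∫ x : Euc n, cutKer n x = 1 := by
  set θ : 𝓢(Euc n, ℂ) := HasCompactSupport.toSchwartzMap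
    (f := fun ξ => ((radialCutoff n ξ : ℝ) : ℂ))
    ((radialCutoff_isTestFun n).clm_comp Complex.ofRealCLM).2
    ((radialCutoff_isTestFun n).clm_comp Complex.ofRealCLM).1 with hθ
  have hval : ∀ ξ, θ ξ = (radialCutoff n ξ : ℂ) := fun ξ => rfl
  have hre : ∀ x, (FourierTransform.fourier θ x).re = cutKer n x := by
    intro x
    rw [SchwartzMap.fourier_coe, Real.fourier_eq, cutKer, oscInt, ← Complex.reCLM_apply,
      ← Complex.reCLM.integral_comp_comm]
    · refine integral_congr_ae (.of_forall fun ξ => ?_)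
      simp [hval, Circle.smul_def]
    · exact (Real.fourierIntegral_convergent_iff x).2 θ.integrable
  have h1 : ∫ x, FourierTransform.fourier θ x = 1 := by
    have h := congrArg (fun s : 𝓢(Euc n, ℂ) => s 0)
      (FourierTransform.fourierInv_fourier_eq (F := 𝓢(Euc n, ℂ)) θ)
    simp only [SchwartzMap.fourierInv_coe, Real.fourierInv_eq] at h
    rw [hval, radialCutoff_of_norm_le (by simp)] at h
    simpa using h
  have h2 := Complex.reCLM.integral_comp_comm (FourierTransform.fourier θ).integrable (μ := volume)
  simp only [Complex.reCLM_apply, hre] at h2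
  rw [h2, h1, Complex.one_re]

theorem exists_abs_cutKer_le (n : ℕ) : ∃ B, 0 ≤ B ∧ ∀ x, |cutKer n x| ≤ B := by
  obtain ⟨s, hs⟩ := exists_schwartz_cutKer n
  obtain ⟨B, hB0, hB⟩ := s.decay 0 0
  refine ⟨B, hB0.le, fun x => ?_⟩
  simpa [hs] using hB x

theorem tendsto_cutKerDil_cocompact {l : ℝ} (hl : 0 < l) :
    Tendsto (cutKerDil n l) (cocompact (Euc n)) (𝓝 0) := by
  obtain ⟨s, hs⟩ := exists_schwartz_cutKer n
  have h : Tendsto (cutKer n) (cocompact (Euc n)) (𝓝 0) := hs ▸ zero_at_infty s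
  have h2 := (h.comp (Homeomorph.smulOfNeZero l hl.ne').isClosedEmbedding.tendsto_cocompact).const_mul
    (l ^ n)
  rw [mul_zero] at h2
  exact h2

/-- Frequency truncation of `u` at scale `l`. -/
noncomputable def freqTrunc (l : ℝ) (u : Euc n → V) (x : Euc n) : V :=
  ∫ y, cutKerDil n l (y - x) • u y

omit [FiniteDimensional ℝ V] in
theorem integrable_cutKerDil_smul (l : ℝ) {u : Euc n → V} (hu : Integrable u) (x : Euc n) :
    Integrable (fun y => cutKerDil n l (y - x) • u y) := by
  obtain ⟨B, -, hB⟩ := exists_abs_cutKer_le n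
  refine hu.bdd_smul (C := |l ^ n| * B) ?_ (.of_forall fun y => ?_)
  · exact ((continuous_cutKerDil l).comp (continuous_sub_right x)).aestronglyMeasurable
  · rw [cutKerDil, Real.norm_eq_abs, abs_mul]
    exact mul_le_mul_of_nonneg_left (hB _) (abs_nonneg _)

omit [FiniteDimensional ℝ V] in
theorem exists_norm_freqTrunc_le (n : ℕ) : ∃ B, 0 ≤ B ∧ ∀ (l : ℝ), 0 < l →
    ∀ u : Euc n → V, Integrable u → ∀ x, ‖freqTrunc l u x‖ ≤ l ^ n * (B * ∫ y, ‖u y‖) := by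
  obtain ⟨B, hB0, hB⟩ := exists_abs_cutKer_le n
  refine ⟨B, hB0, fun l hl u hu x => ?_⟩
  rw [← mul_assoc, ← integral_const_mul]
  refine norm_integral_le_of_norm_le (hu.norm.const_mul _) (.of_forall fun y => ?_)
  rw [norm_smul, cutKerDil, Real.norm_eq_abs, abs_mul, abs_of_pos (pow_pos hl n)]
  gcongr
  exact hB _

omit [FiniteDimensional ℝ V] in
theorem continuous_freqTrunc (l : ℝ) {u : Euc n → V} (hu : Integrable u) :
    Continuous (freqTrunc l u) := by
  obtain ⟨B, -, hB⟩ := exists_abs_cutKer_le n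
  refine continuous_of_dominated (bound := fun y => |l ^ n| * B * ‖u y‖)
    (fun x => (integrable_cutKerDil_smul l hu x).aestronglyMeasurable)
    (fun x => .of_forall fun y => ?_) (hu.norm.const_mul _) (.of_forall fun y => ?_)
  · rw [norm_smul, cutKerDil, Real.norm_eq_abs, abs_mul]
    gcongr
    exact hB _
  · exact ((continuous_cutKerDil l).comp (continuous_sub_left y)).smul continuous_const

omit [FiniteDimensional ℝ V] in
theorem tendsto_freqTrunc_cocompact {l : ℝ} (hl : 0 < l) {u : Euc n → V} (hu : Integrable u) :
    Tendsto (freqTrunc l u) (cocompact (Euc n)) (𝓝 0) := by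
  obtain ⟨B, -, hB⟩ := exists_abs_cutKer_le n
  rw [← integral_zero (Euc n) V (μ := volume)]
  have : (cocompact (Euc n)).IsCountablyGenerated := by
    rw [← cobounded_eq_cocompact, ← comap_norm_atTop]
    infer_instance
  refine tendsto_integral_filter_of_dominated_convergence (fun y => |l ^ n| * B * ‖u y‖)
    (.of_forall fun x => (integrable_cutKerDil_smul l hu x).aestronglyMeasurable)
    (.of_forall fun x => .of_forall fun y => ?_) (hu.norm.const_mul _) (.of_forall fun y => ?_)
  · rw [norm_smul, cutKerDil, Real.norm_eq_abs, abs_mul]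
    gcongr
    exact hB _
  · have h := (tendsto_cutKerDil_cocompact hl).comp
      (Homeomorph.subLeft y).isClosedEmbedding.tendsto_cocompact
    have h2 := h.smul_const (u y)
    rw [zero_smul] at h2
    exact h2

theorem tendsto_integral_cutKerDil_mul {ψ : Euc n → ℝ} (hψ : Continuous ψ)
    (hc : HasCompactSupport ψ) (y : Euc n) {l : ℕ → ℝ} (hl : ∀ k, 0 < l k)
    (hlim : Tendsto l atTop atTop) :
    Tendsto (fun k => ∫ x, ψ x * cutKerDil n (l k) (y - x)) atTop (𝓝 (ψ y)) := by
  obtain ⟨K, hK⟩ := hc.exists_bound_of_continuous hψ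
  have e : ∀ k, ∫ x, ψ x * cutKerDil n (l k) (y - x) =
      ∫ z, ψ (y - (l k)⁻¹ • z) * cutKer n z := by
    intro k
    have h1 := integral_sub_left_eq_self (fun x => ψ x * cutKerDil n (l k) (y - x)) volume y
    have h2 := Measure.integral_comp_smul (volume : Measure (Euc n))
      (fun z => ψ (y - (l k)⁻¹ • z) * cutKer n z) (l k)
    have hp : 0 < l k ^ n := pow_pos (hl k) n
    rw [← h1]
    simp only [sub_sub_cancel, cutKerDil]
    simp only [smul_smul, inv_mul_cancel₀ (hl k).ne', one_smul, finrank_euclideanSpace,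
      Fintype.card_fin, abs_of_pos (inv_pos.2 hp), smul_eq_mul] at h2
    rw [eq_inv_mul_iff_mul_eq₀ hp.ne'] at h2
    rw [← h2, ← integral_const_mul]
    refine integral_congr_ae (.of_forall fun z => ?_)
    simp only []
    ring
  simp only [e]
  have hone : ψ y = ∫ z, ψ y * cutKer n z := by
    rw [integral_const_mul, integral_cutKer, mul_one]
  rw [hone]
  refine tendsto_integral_of_dominated_convergence (fun z => K * |cutKer n z|) (fun k => ?_)
    (integrable_cutKer.abs.const_mul K) (fun k => .of_forall fun z => ?_)
    (.of_forall fun z => ?_)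
  · exact ((hψ.comp (continuous_const.sub (continuous_const_smul _))).mul
      continuous_cutKer).aestronglyMeasurable
  · rw [norm_mul, Real.norm_eq_abs (cutKer n z)]
    exact mul_le_mul_of_nonneg_right (hK _) (abs_nonneg _)
  · have h0 : Tendsto (fun k => y - (l k)⁻¹ • z) atTop (𝓝 y) := by
      have := (hlim.inv_tendsto_atTop.smul_const z).const_sub y
      simpa using this
    exact ((hψ.tendsto y).comp h0).mul_const _

theorem integral_smul_freqTrunc {ψ : Euc n → ℝ} (hψ : Continuous ψ) (hc : HasCompactSupport ψ)
    {u : Euc n → V} (hu : Integrable u) (l : ℝ) :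
    ∫ x, ψ x • freqTrunc l u x = ∫ y, (∫ x, ψ x * cutKerDil n l (y - x)) • u y := by
  obtain ⟨B, -, hB⟩ := exists_abs_cutKer_le n
  have := FiniteDimensional.complete ℝ V
  simp only [freqTrunc, ← integral_smul]
  rw [integral_integral_swap]
  · simp only [smul_smul, integral_smul_const]
  · have h := (hψ.integrable_of_hasCompactSupport (μ := volume) hc).smul_prod hu
    have h2 : Integrable (fun p : Euc n × Euc n =>
        cutKerDil n l (p.2 - p.1) • (ψ p.1 • u p.2)) (volume.prod volume) := by
      refine h.bdd_smul (C := |l ^ n| * B) ?_ (.of_forall fun p => ?_)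
      · exact ((continuous_cutKerDil l).comp
          (continuous_snd.sub continuous_fst)).aestronglyMeasurable
      · rw [cutKerDil, Real.norm_eq_abs, abs_mul]
        exact mul_le_mul_of_nonneg_left (hB _) (abs_nonneg _)
    refine h2.congr (.of_forall fun p => ?_)
    simp only [Function.uncurry]
    rw [smul_comm]

theorem tendsto_integral_smul_freqTrunc {ψ : Euc n → ℝ} (hψ : Continuous ψ)
    (hc : HasCompactSupport ψ) {u : Euc n → V} (hu : Integrable u) {l : ℕ → ℝ}
    (hl : ∀ k, 0 < l k) (hlim : Tendsto l atTop atTop) :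
    Tendsto (fun k => ∫ x, ψ x • freqTrunc (l k) u x) atTop (𝓝 (∫ y, ψ y • u y)) := by
  obtain ⟨K, hK⟩ := hc.exists_bound_of_continuous hψ
  simp only [integral_smul_freqTrunc hψ hc hu]
  set H : ℝ := ∫ x : Euc n, |cutKer n x|
  have hcont : ∀ k, Continuous fun y => ∫ x, ψ x * cutKerDil n (l k) (y - x) := by
    intro k
    obtain ⟨B, -, hB⟩ := exists_abs_cutKer_le n
    refine continuous_of_dominated (bound := fun x => ‖ψ x‖ * (|l k ^ n| * B)) (fun y => ?_)
      (fun y => .of_forall fun x => ?_)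
      ((hψ.integrable_of_hasCompactSupport hc).norm.mul_const _) (.of_forall fun x => ?_)
    · exact (hψ.mul ((continuous_cutKerDil _).comp
        (continuous_sub_left y))).aestronglyMeasurable
    · rw [norm_mul, cutKerDil, Real.norm_eq_abs (_ * _), abs_mul]
      gcongr
      exact hB _
    · exact continuous_const.mul ((continuous_cutKerDil _).comp (continuous_sub_right x))
  refine tendsto_integral_of_dominated_convergence (fun y => K * H * ‖u y‖) (fun k => ?_)
    (hu.norm.const_mul _) (fun k => .of_forall fun y => ?_) (.of_forall fun y => ?_)
  · exact (hcont k).aestronglyMeasurable.smul hu.aestronglyMeasurable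
  · rw [norm_smul]
    refine mul_le_mul_of_nonneg_right ?_ (norm_nonneg _)
    have h1 : ∫ x, K * |cutKerDil n (l k) (y - x)| = K * H := by
      rw [integral_const_mul, integral_sub_left_eq_self (fun x => |cutKerDil n (l k) x|) volume y,
        integral_abs_cutKerDil (hl k)]
    rw [← h1]
    refine norm_integral_le_of_norm_le
      (((integrable_cutKerDil (hl k)).comp_sub_left y).abs.const_mul K) (.of_forall fun x => ?_)
    rw [norm_mul, Real.norm_eq_abs (cutKerDil _ _ _)]
    exact mul_le_mul_of_nonneg_right (hK _) (abs_nonneg _)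
  · exact (tendsto_integral_cutKerDil_mul hψ hc y hl hlim).smul_const _

end Smoothing

section Sufficiency

open scoped SchwartzMap ContDiff

variable {n : ℕ} {V W : Type*}
  [NormedAddCommGroup V] [InnerProductSpace ℝ V] [FiniteDimensional ℝ V]
  [NormedAddCommGroup W] [InnerProductSpace ℝ W] [FiniteDimensional ℝ W]

theorem HasDistribA.exists_inner_freqTrunc_sub_le {A : CoeffOp n n V W}
    {M : Euc n → W →L[ℝ] V} (hM : IsHomMult M)
    (hinv : ∀ ξ, ξ ≠ 0 → ∀ v, M ξ (symCLM A ξ v) = v)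
    (hcan : ∀ w, ∫ ξ, annularBump n ξ • M ξ w = 0) (v : V) :
    ∃ C, 0 ≤ C ∧ ∀ (u : Euc n → V) (σ : Measure (Euc n)) (f : Euc n → W),
      Integrable u → Integrable f σ → HasDistribA n n A u σ f →
      ∀ l : ℝ, 0 < l → ∀ (N : ℕ) (x : Euc n),
        |⟪v, freqTrunc (2 ^ N * l) u x - freqTrunc l u x⟫| ≤
          C * ∫ y, ‖f y‖ * (1 + l * ‖y - x‖)⁻¹ ∂σ := by
  obtain ⟨C, hC0, hC⟩ := exists_dual_kernel hM hinv hcan v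
  refine ⟨C, hC0, fun u σ f hu hf h l hl N x => ?_⟩
  obtain ⟨s, hs, hsd⟩ := hC l hl N
  have hφ : ContDiff ℝ (⊤ : ℕ∞) (fun y => s (y - x)) :=
    (s.smooth ⊤).comp (contDiff_id.sub contDiff_const)
  have key := h.of_bounded hu hf hφ fun m => by
    obtain ⟨B, -, hB⟩ := s.decay 0 m
    refine ⟨B, fun y => ?_⟩
    rw [iteratedFDeriv_comp_sub]
    simpa using hB (y - x)
  have hd : ∀ I y, dirDeriv n n I (fun y => s (y - x)) y = dirDeriv n n I s (y - x) := by
    intro I y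
    simp only [dirDeriv, iteratedFDeriv_comp_sub]
  have h1 := integrable_cutKerDil_smul (2 ^ N * l) hu x
  have h2 := integrable_cutKerDil_smul l hu x
  have hsum : ∑ I : Fin n → Fin n,
      ∫ y, ⟪u y, LinearMap.adjoint (A I) (dirDeriv n n I (fun y => s (y - x)) y)⟫ =
      ⟪v, freqTrunc (2 ^ N * l) u x - freqTrunc l u x⟫ := by
    rw [← integral_finsetSum]
    · simp only [← inner_sum, hd, hsd]
      have := FiniteDimensional.complete ℝ V
      have h3 := (innerSL ℝ v).integral_comp_comm (h1.sub h2)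
      simp only [Pi.sub_apply] at h3
      rw [freqTrunc, freqTrunc, ← integral_sub h1 h2, ← innerSL_apply_apply ℝ v, ← h3]
      refine integral_congr_ae (.of_forall fun y => ?_)
      simp only [innerSL_apply_apply, ← sub_smul, real_inner_smul_right, real_inner_comm]
    · intro I _
      obtain ⟨B, -, hB⟩ := s.decay 0 n
      set T : W →L[ℝ] V := LinearMap.toContinuousLinearMap (LinearMap.adjoint (A I))
      have hT : Continuous fun y =>
          T (dirDeriv n n I (fun y => s (y - x)) y) :=
        T.continuous.comp (continuous_dirDeriv I hφ)
      refine (hu.norm.mul_const (‖T‖ * B)).mono'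
        (hu.aestronglyMeasurable.inner hT.aestronglyMeasurable) (.of_forall fun y => ?_)
      refine (norm_inner_le_norm _ _).trans (mul_le_mul_of_nonneg_left ?_ (norm_nonneg _))
      refine (T.le_opNorm _).trans (mul_le_mul_of_nonneg_left ?_ (norm_nonneg _))
      rw [hd]
      exact (norm_dirDeriv_le I s _).trans (by simpa using hB (y - x))
  rw [hsum] at key
  have habs : |⟪v, freqTrunc (2 ^ N * l) u x - freqTrunc l u x⟫| =
      ‖∫ y, ⟪f y, s (y - x)⟫ ∂σ‖ := by
    rw [← key, Real.norm_eq_abs, abs_mul, abs_pow, abs_neg, abs_one, one_pow, one_mul]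
  rw [habs, ← integral_const_mul]
  have hint : Integrable (fun y => ‖f y‖ * (1 + l * ‖y - x‖)⁻¹) σ := by
    refine hf.norm.mul_bdd (c := 1) ?_ (.of_forall fun y => ?_)
    · refine Continuous.aestronglyMeasurable ?_
      exact Continuous.inv₀ (by fun_prop) fun y => by positivity
    · rw [Real.norm_of_nonneg (by positivity)]
      exact inv_le_one_of_one_le₀ (by simp; positivity)
  refine norm_integral_le_of_norm_le (hint.const_mul C) (.of_forall fun y => ?_)
  refine (norm_inner_le_norm _ _).trans ?_
  have := mul_le_mul_of_nonneg_left (hs (y - x)) (norm_nonneg (f y))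
  linarith

theorem exists_norm_freqTrunc_sub_le (hn : 1 ≤ n) {A : CoeffOp n n V W}
    (hell : IsElliptic n n A) (hwc : IsWeaklyCanceling n n A) :
    ∃ C, 0 ≤ C ∧ ∀ (u : Euc n → V) (σ : Measure (Euc n)) (f : Euc n → W),
      Integrable u → Integrable f σ → HasDistribA n n A u σ f →
      ∀ l : ℝ, 0 < l → ∀ (N : ℕ) (x : Euc n),
        ‖freqTrunc (2 ^ N * l) u x - freqTrunc l u x‖ ≤
          C * ∫ y, ‖f y‖ * (1 + l * ‖y - x‖)⁻¹ ∂σ := by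
  obtain ⟨M, hM, hinv, hcan⟩ := exists_modified_multiplier hn hell hwc
  set b := stdOrthonormalBasis ℝ V
  choose C hC0 hC using fun i =>
    HasDistribA.exists_inner_freqTrunc_sub_le hM hinv hcan (b i)
  refine ⟨∑ i, C i, Finset.sum_nonneg fun i _ => hC0 i, fun u σ f hu hf h l hl N x => ?_⟩
  rw [Finset.sum_mul]
  conv_lhs => rw [← b.sum_repr (freqTrunc (2 ^ N * l) u x - freqTrunc l u x)]
  refine (norm_sum_le _ _).trans (Finset.sum_le_sum fun i _ => ?_)
  rw [norm_smul, b.norm_eq_one, mul_one, b.repr_apply_apply, Real.norm_eq_abs]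
  exact hC i u σ f hu hf h l hl N x

theorem exists_norm_freqTrunc_le_of_hasDistribA (hn : 1 ≤ n) {A : CoeffOp n n V W}
    (hell : IsElliptic n n A) (hwc : IsWeaklyCanceling n n A) :
    ∃ C, 0 ≤ C ∧ ∀ (u : Euc n → V) (σ : Measure (Euc n)) (f : Euc n → W),
      Integrable u → Integrable f σ → HasDistribA n n A u σ f →
      ∀ l : ℝ, 0 < l → ∀ x : Euc n, ‖freqTrunc l u x‖ ≤ C * ∫ y, ‖f y‖ ∂σ := by
  obtain ⟨C, hC0, hC⟩ := exists_norm_freqTrunc_sub_le hn hell hwc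
  obtain ⟨B, hB0, hB⟩ := exists_norm_freqTrunc_le (V := V) n
  refine ⟨C, hC0, fun u σ f hu hf h l hl x => ?_⟩
  have hlim : Tendsto (fun N : ℕ => C * (∫ y, ‖f y‖ ∂σ) +
      (((1 / 2 : ℝ) ^ N) * l) ^ n * (B * ∫ y, ‖u y‖)) atTop
      (𝓝 (C * (∫ y, ‖f y‖ ∂σ) + (0 * l) ^ n * (B * ∫ y, ‖u y‖))) :=
    ((((tendsto_pow_atTop_nhds_zero_of_lt_one (by norm_num) (by norm_num)).mul_const
      l).pow n).mul_const _).const_add _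
  rw [zero_mul, zero_pow (by omega), zero_mul, add_zero] at hlim
  refine ge_of_tendsto' hlim fun N => ?_
  have hl' : 0 < (1 / 2 : ℝ) ^ N * l := by positivity
  have h1 := hC u σ f hu hf h _ hl' N x
  have e : (2 : ℝ) ^ N * ((1 / 2) ^ N * l) = l := by
    rw [← mul_assoc, ← mul_pow]; norm_num
  rw [e] at h1
  have h2 := hB _ hl' u hu x
  have h3 : ∫ y, ‖f y‖ * (1 + (1 / 2 : ℝ) ^ N * l * ‖y - x‖)⁻¹ ∂σ ≤ ∫ y, ‖f y‖ ∂σ := by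
    refine integral_mono_of_nonneg (.of_forall fun y => by positivity) hf.norm
      (.of_forall fun y => ?_)
    exact mul_le_of_le_one_right (norm_nonneg _)
      (inv_le_one_of_one_le₀ (by simp; positivity))
  calc ‖freqTrunc l u x‖ ≤ ‖freqTrunc l u x - freqTrunc ((1 / 2 : ℝ) ^ N * l) u x‖ +
        ‖freqTrunc ((1 / 2 : ℝ) ^ N * l) u x‖ := by
        simpa using norm_add_le (freqTrunc l u x - freqTrunc ((1 / 2 : ℝ) ^ N * l) u x)
          (freqTrunc ((1 / 2 : ℝ) ^ N * l) u x)
    _ ≤ _ := add_le_add (h1.trans (mul_le_mul_of_nonneg_left h3 hC0)) h2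

theorem exists_norm_le_ae_of_isWeaklyCanceling (hn : 1 ≤ n) {A : CoeffOp n n V W}
    (hell : IsElliptic n n A) (hwc : IsWeaklyCanceling n n A) :
    ∃ c : ℝ, ∀ (u : Euc n → V) (σ : Measure (Euc n)) (f : Euc n → W),
        Integrable u volume → IsFiniteMeasure σ → Integrable f σ →
          (∀ᵐ x ∂σ, ‖f x‖ = 1) → HasDistribA n n A u σ f →
          ∀ᵐ x ∂(volume : Measure (Euc n)), ‖u x‖ ≤ c * (σ Set.univ).toReal := by
  obtain ⟨C, hC0, hC⟩ := exists_norm_freqTrunc_le_of_hasDistribA hn hell hwc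
  refine ⟨C, fun u σ f hu _ hf hf1 h => ?_⟩
  have hσ : ∫ y, ‖f y‖ ∂σ = (σ Set.univ).toReal := by
    rw [integral_congr_ae hf1]
    simp [Measure.real]
  have := FiniteDimensional.complete ℝ V
  have hψ : ∀ ψ : Euc n → ℝ, Continuous ψ → HasCompactSupport ψ →
      ‖∫ y, ψ y • u y‖ ≤ C * (σ Set.univ).toReal * ∫ y, ‖ψ y‖ := by
    intro ψ hψ hc
    have hlim := (tendsto_integral_smul_freqTrunc hψ hc hu (l := fun k => (k : ℝ) + 1)
      (fun k => by positivity) (tendsto_natCast_atTop_atTop.atTop_add tendsto_const_nhds)).norm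
    refine le_of_tendsto' hlim fun k => ?_
    rw [← integral_const_mul]
    refine norm_integral_le_of_norm_le
      ((hψ.integrable_of_hasCompactSupport hc).norm.const_mul _) (.of_forall fun x => ?_)
    rw [norm_smul, mul_comm]
    refine mul_le_mul_of_nonneg_right ?_ (norm_nonneg _)
    rw [← hσ]
    exact hC u σ f hu hf h _ (by positivity) x
  let φ : ℕ → ContDiffBump (0 : Euc n) := fun k =>
    ⟨((k : ℝ) + 1)⁻¹, 2 * ((k : ℝ) + 1)⁻¹, by positivity, by
      have : 0 < ((k : ℝ) + 1)⁻¹ := by positivity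
      linarith⟩
  have hφ : Tendsto (fun k => (φ k).rOut) atTop (𝓝 0) := by
    have := (tendsto_one_div_add_atTop_nhds_zero_nat (𝕜 := ℝ)).const_mul 2
    simpa [φ] using this
  filter_upwards [ContDiffBump.ae_convolution_tendsto_right_of_locallyIntegrable
    (μ := volume) (φ := φ) (K := 2) hφ (.of_forall fun k => le_rfl)
    hu.locallyIntegrable] with x hx
  refine le_of_tendsto' hx.norm fun k => ?_
  rw [convolution_eq_swap]
  have h1 := hψ (fun y => (φ k).normed volume (x - y))
    ((φ k).continuous_normed.comp (continuous_sub_left x))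
    ((φ k).hasCompactSupport_normed.comp_isClosedEmbedding
      (Homeomorph.subLeft x).isClosedEmbedding)
  refine h1.trans_eq ?_
  have h2 : ∀ y, ‖(φ k).normed volume (x - y)‖ = (φ k).normed volume (x - y) := fun y =>
    Real.norm_of_nonneg ((φ k).nonneg_normed _)
  simp only [h2]
  rw [integral_sub_left_eq_self (fun y => (φ k).normed volume y) volume x,
    (φ k).integral_normed, mul_one]

omit [InnerProductSpace ℝ W] [FiniteDimensional ℝ W] in
theorem exists_forall_integral_norm_mul_inv_le (hn : 1 ≤ n) {g : Euc n → W} (hg : Integrable g)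
    {ε : ℝ} (hε : 0 < ε) : ∃ L : ℝ, 0 < L ∧ ∀ l, L ≤ l → ∀ x : Euc n,
      ∫ y, ‖g y‖ * (1 + l * ‖y - x‖)⁻¹ ≤ ε := by
  have hfin : ∫⁻ y, ‖g y‖ₑ ≠ ⊤ := hg.2.ne
  obtain ⟨δ, hδ, hδ'⟩ := exists_pos_setLIntegral_lt_of_measure_lt hfin
    (ε := ENNReal.ofReal (ε / 2)) (by simpa using hε)
  have hr : ∃ r : ℝ, 0 < r ∧ ∀ x : Euc n, volume (ball x r) < δ := by
    have hlim : Tendsto (fun r : ℝ => ENNReal.ofReal (r ^ n) * volume (ball (0 : Euc n) 1))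
        (𝓝[>] 0) (𝓝 (ENNReal.ofReal (0 ^ n) * volume (ball (0 : Euc n) 1))) := by
      refine ENNReal.Tendsto.mul_const ?_ (Or.inr measure_ball_lt_top.ne)
      refine ENNReal.tendsto_ofReal ?_
      exact ((continuous_pow n).tendsto 0).mono_left nhdsWithin_le_nhds
    rw [zero_pow (by omega), ENNReal.ofReal_zero, zero_mul] at hlim
    obtain ⟨r, hr1, hr2⟩ := ((hlim.eventually_lt_const hδ).and self_mem_nhdsWithin).exists
    refine ⟨r, hr2, fun x => ?_⟩
    rw [Measure.addHaar_ball_of_pos _ _ hr2, finrank_euclideanSpace, Fintype.card_fin]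
    exact hr1
  obtain ⟨r, hr0, hr⟩ := hr
  set G := ∫ y, ‖g y‖
  have hG : 0 ≤ G := integral_nonneg fun y => norm_nonneg _
  refine ⟨(2 * G + 1) / (ε * r), by positivity, fun l hl x => ?_⟩
  have hl0 : 0 < l := lt_of_lt_of_le (by positivity) hl
  have h1 : ∫ y in ball x r, ‖g y‖ ≤ ε / 2 := by
    rw [integral_norm_eq_lintegral_enorm hg.aestronglyMeasurable.restrict]
    exact ENNReal.toReal_le_of_le_ofReal (by positivity) (hδ' _ (hr x)).le
  have h2 : (1 + l * r)⁻¹ * G ≤ ε / 2 := by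
    rw [div_le_iff₀ (by positivity)] at hl
    rw [inv_mul_le_iff₀ (by positivity)]
    nlinarith
  have hi1 : Integrable ((ball x r).indicator fun y => ‖g y‖) :=
    hg.norm.indicator measurableSet_ball
  have hi2 : Integrable fun y => (1 + l * r)⁻¹ * ‖g y‖ := hg.norm.const_mul _
  calc ∫ y, ‖g y‖ * (1 + l * ‖y - x‖)⁻¹
      ≤ ∫ y, ((ball x r).indicator (fun y => ‖g y‖) y + (1 + l * r)⁻¹ * ‖g y‖) := by
        refine integral_mono_of_nonneg (.of_forall fun y => by positivity) (hi1.add hi2)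
          (.of_forall fun y => ?_)
        by_cases hy : y ∈ ball x r
        · simp only [Set.indicator_of_mem hy]
          have : ‖g y‖ * (1 + l * ‖y - x‖)⁻¹ ≤ ‖g y‖ :=
            mul_le_of_le_one_right (norm_nonneg _)
              (inv_le_one_of_one_le₀ (by simp; positivity))
          have : 0 ≤ (1 + l * r)⁻¹ * ‖g y‖ := by positivity
          linarith
        · simp only [Set.indicator_of_notMem hy, zero_add]
          rw [mul_comm]
          rw [mem_ball, dist_eq_norm, not_lt] at hy
          gcongr
    _ = (∫ y in ball x r, ‖g y‖) + (1 + l * r)⁻¹ * G := by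
        rw [integral_add hi1 hi2, integral_indicator measurableSet_ball, integral_const_mul]
    _ ≤ ε := by linarith

theorem exists_embedding_of_isWeaklyCanceling (hn : 1 ≤ n) {A : CoeffOp n n V W}
    (hell : IsElliptic n n A) (hwc : IsWeaklyCanceling n n A) :
    ∃ C : ℝ, ∀ (u : Euc n → V) (g : Euc n → W),
        Integrable u volume → Integrable g volume → HasDistribA n n A u volume g →
          ∃ v : Euc n → V, Continuous v ∧ Tendsto v (cocompact (Euc n)) (𝓝 0) ∧
            v =ᵐ[volume] u ∧
            ∀ x, ‖v x‖ ≤ C * ((∫ y, ‖u y‖) + ∫ y, ‖g y‖) := by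
  obtain ⟨C, hC0, hC⟩ := exists_norm_freqTrunc_le_of_hasDistribA hn hell hwc
  obtain ⟨C', hC0', hC'⟩ := exists_norm_freqTrunc_sub_le hn hell hwc
  refine ⟨C, fun u g hu hg h => ?_⟩
  have := FiniteDimensional.complete ℝ V
  have hpos : ∀ k : ℕ, (0 : ℝ) < 2 ^ k := fun k => by positivity
  let F : ℕ → ZeroAtInftyContinuousMap (Euc n) V := fun k =>
    ⟨⟨freqTrunc (2 ^ k) u, continuous_freqTrunc _ hu⟩, tendsto_freqTrunc_cocompact (hpos k) hu⟩
  have hF : ∀ k x, F k x = freqTrunc (2 ^ k) u x := fun _ _ => rfl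
  have hpow : Tendsto (fun k : ℕ => (2 : ℝ) ^ k) atTop atTop :=
    tendsto_pow_atTop_atTop_of_one_lt (by norm_num)
  have hcauchy : CauchySeq F := by
    rw [Metric.cauchySeq_iff']
    intro ε hε
    obtain ⟨L, -, hL⟩ := exists_forall_integral_norm_mul_inv_le hn hg
      (ε := ε / (2 * (C' + 1))) (by positivity)
    obtain ⟨K, hK⟩ := (hpow.eventually_ge_atTop L).exists
    refine ⟨K, fun k hk => ?_⟩
    obtain ⟨N, rfl⟩ := Nat.exists_eq_add_of_le' hk
    have hle : dist (F (N + K)) (F K) ≤ ε / 2 := by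
      rw [← ZeroAtInftyContinuousMap.dist_toBCF_eq_dist,
        BoundedContinuousFunction.dist_le (by positivity)]
      intro x
      rw [dist_eq_norm]
      change ‖freqTrunc (2 ^ (N + K)) u x - freqTrunc (2 ^ K) u x‖ ≤ _
      rw [pow_add]
      refine (hC' u volume g hu hg h _ (hpos K) N x).trans ?_
      have h1 := mul_le_mul_of_nonneg_left (hL _ hK x) hC0'
      refine h1.trans ?_
      rw [mul_div_assoc', div_le_div_iff₀ (by positivity) (by positivity)]
      nlinarith
    linarith
  obtain ⟨v, hv⟩ := cauchySeq_tendsto_of_complete hcauchy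
  have hpt : ∀ x, Tendsto (fun k => freqTrunc (2 ^ k) u x) atTop (𝓝 (v x)) := by
    intro x
    rw [tendsto_iff_dist_tendsto_zero] at hv ⊢
    refine squeeze_zero (fun _ => dist_nonneg) (fun k => ?_) hv
    rw [← ZeroAtInftyContinuousMap.dist_toBCF_eq_dist]
    exact BoundedContinuousFunction.dist_coe_le_dist (f := (F k).toBCF) (g := v.toBCF) x
  have hvb : ∀ x, ‖v x‖ ≤ C * ∫ y, ‖g y‖ := fun x =>
    le_of_tendsto' (hpt x).norm fun k => hC u volume g hu hg h _ (hpos k) x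
  refine ⟨v, v.continuous, v.zero_at_infty', ?_, fun x => (hvb x).trans ?_⟩
  · refine ae_eq_of_integral_contDiff_smul_eq v.continuous.locallyIntegrable
      hu.locallyIntegrable fun ψ hψ hc => ?_
    refine tendsto_nhds_unique ?_
      (tendsto_integral_smul_freqTrunc hψ.continuous hc hu hpos hpow)
    refine tendsto_integral_of_dominated_convergence
      (fun x => ‖ψ x‖ * (C * ∫ y, ‖g y‖)) (fun k => ?_)
      ((hψ.continuous.integrable_of_hasCompactSupport hc).norm.mul_const _)
      (fun k => .of_forall fun x => ?_) (.of_forall fun x => (hpt x).const_smul _)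
    · exact (hψ.continuous.smul (continuous_freqTrunc _ hu)).aestronglyMeasurable
    · rw [norm_smul]
      exact mul_le_mul_of_nonneg_left (hC u volume g hu hg h _ (hpos k) x) (norm_nonneg _)
  · exact mul_le_mul_of_nonneg_left
      (le_add_of_nonneg_left (integral_nonneg fun y => norm_nonneg _)) hC0

end Sufficiency

/-- Theorem 4.1: for an elliptic operator `𝒜` of order `k = n`,
the following are equivalent: (1) condition (WC); (2) `W^{𝒜,1}(ℝ^n)` embeds continuously
into `C₀(ℝ^n, V)`; (3) `BV^𝒜(ℝ^n) ⊂ L^∞(ℝ^n, V)` with `‖u‖_{L^∞} ≤ c |𝒜 u|(ℝ^n)`. -/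
theorem statement8 (n : ℕ) (hn : 1 ≤ n) {V W : Type*}
    [NormedAddCommGroup V] [InnerProductSpace ℝ V] [FiniteDimensional ℝ V]
    [NormedAddCommGroup W] [InnerProductSpace ℝ W] [FiniteDimensional ℝ W]
    (A : CoeffOp n n V W) (hA : IsSymmetricOp n n A) (hell : IsElliptic n n A) :
    (IsWeaklyCanceling n n A ↔
      ∃ C : ℝ, ∀ (u : Euc n → V) (g : Euc n → W),
        Integrable u volume → Integrable g volume → HasDistribA n n A u volume g →
          ∃ v : Euc n → V, Continuous v ∧ Tendsto v (cocompact (Euc n)) (𝓝 0) ∧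
            v =ᵐ[volume] u ∧
            ∀ x, ‖v x‖ ≤ C * ((∫ y, ‖u y‖) + ∫ y, ‖g y‖)) ∧
    (IsWeaklyCanceling n n A ↔
      ∃ c : ℝ, ∀ (u : Euc n → V) (σ : Measure (Euc n)) (f : Euc n → W),
        Integrable u volume → IsFiniteMeasure σ → Integrable f σ →
          (∀ᵐ x ∂σ, ‖f x‖ = 1) → HasDistribA n n A u σ f →
          ∀ᵐ x ∂(volume : Measure (Euc n)), ‖u x‖ ≤ c * (σ Set.univ).toReal) :=
  ⟨⟨exists_embedding_of_isWeaklyCanceling hn hell, isWeaklyCanceling_of_embedding hn hell⟩,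
    ⟨exists_norm_le_ae_of_isWeaklyCanceling hn hell, isWeaklyCanceling_of_bounded hn hell⟩⟩
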